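/- For every positive integer t there exists ε_t > 0 such that every K_{t,t}-free graph on n ≥ 16 vertices whose average degree d satisfies d ≥ 2·log₂ log₂ n has a 64-almost-regular subgraph with average degree at least ε_t·(d/log₂ log₂ n)^{1/2}/log₂(d/log₂ log₂ n). -/

import Mathlib

variable {V : Type*}

/-- `G` is a bipartite graph with parts `A` and `B`: the parts are disjoint, cover all
vertices, and every edge goes between `A` and `B`. -/
def BipartiteWith (G : SimpleGraph V) (A B : Set V) : Prop :=
  Disjoint A B ∧ A ∪ B = Set.univ ∧
    ∀ ⦃u v : V⦄, G.Adj u v → (u ∈ A ∧ v ∈ B) ∨ (u ∈ B ∧ v ∈ A)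

/-- `G` contains no complete bipartite subgraph `K_{k,k}`. -/
def KkkFree (G : SimpleGraph V) (k : ℕ) : Prop :=
  ¬ ∃ (S T : Finset V), Disjoint S T ∧ S.card = k ∧ T.card = k ∧
      ∀ u ∈ S, ∀ v ∈ T, G.Adj u v

/-- The number of edges of `G`. -/
noncomputable def edgeCount (G : SimpleGraph V) : ℕ := G.edgeSet.ncard

/-- The degree of `v` in `G`. -/
noncomputable def deg (G : SimpleGraph V) (v : V) : ℕ := (G.neighborSet v).ncard

/-- The codegree of `u` and `u'` in `G`: the number of their common neighbours. -/
noncomputable def codeg (G : SimpleGraph V) (u u' : V) : ℕ :=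
  (G.neighborSet u ∩ G.neighborSet u').ncard

/-- The average degree of `G`, as a real number. -/
noncomputable def avgDeg [Fintype V] (G : SimpleGraph V) : ℝ :=
  2 * (edgeCount G : ℝ) / (Fintype.card V : ℝ)

/-- The number of edges of a subgraph. -/
noncomputable def subEdgeCount {G : SimpleGraph V} (H : G.Subgraph) : ℕ := H.edgeSet.ncard

/-- The degree of a vertex in a subgraph. -/
noncomputable def subDeg {G : SimpleGraph V} (H : G.Subgraph) (v : V) : ℕ :=
  (H.neighborSet v).ncard

/-- The average degree of a subgraph. -/
noncomputable def subAvgDeg {G : SimpleGraph V} (H : G.Subgraph) : ℝ :=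
  2 * (subEdgeCount H : ℝ) / (H.verts.ncard : ℝ)

/-- A subgraph `H` is `K`-almost-regular: its maximum degree is at most `K` times its
minimum degree. -/
def SubAlmostRegular {G : SimpleGraph V} (H : G.Subgraph) (K : ℝ) : Prop :=
  ∀ v ∈ H.verts, ∀ w ∈ H.verts, (subDeg H v : ℝ) ≤ K * (subDeg H w : ℝ)

/-- `G` has a nonempty `k`-regular subgraph. -/
def HasRegularSubgraph (G : SimpleGraph V) (k : ℕ) : Prop :=
  ∃ H : G.Subgraph, H.verts.Nonempty ∧ ∀ v ∈ H.verts, subDeg H v = k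

/-- `G` has a nonempty `K`-almost-regular subgraph with average degree at least `c`. -/
def HasAlmostRegularSubgraph (G : SimpleGraph V) (K : ℝ) (c : ℝ) : Prop :=
  ∃ H : G.Subgraph, H.verts.Nonempty ∧ SubAlmostRegular H K ∧ c ≤ subAvgDeg H

/-- `G` is `(L, d)`-almost-biregular with parts `A` and `B`. -/
def IsAlmostBiregular (G : SimpleGraph V) (A B : Set V) (L : ℝ) (d : ℕ) : Prop :=
  BipartiteWith G A B ∧ A.Nonempty ∧
    (∀ v ∈ B, deg G v = d) ∧
    (d : ℝ) ≤ (edgeCount G : ℝ) / (A.ncard : ℝ) ∧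
    ∀ u ∈ A, (deg G u : ℝ) ≤ L * ((edgeCount G : ℝ) / (A.ncard : ℝ))

/-- A subgraph `H` of `G` is `(L, d)`-almost-biregular with parts `A` and `B`. -/
def SubIsAlmostBiregular {G : SimpleGraph V} (H : G.Subgraph) (A B : Set V)
    (L : ℝ) (d : ℕ) : Prop :=
  Disjoint A B ∧ A ∪ B = H.verts ∧
    (∀ ⦃u v : V⦄, H.Adj u v → (u ∈ A ∧ v ∈ B) ∨ (u ∈ B ∧ v ∈ A)) ∧
    A.Nonempty ∧
    (∀ v ∈ B, subDeg H v = d) ∧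
    (d : ℝ) ≤ (subEdgeCount H : ℝ) / (A.ncard : ℝ) ∧
    ∀ u ∈ A, (subDeg H u : ℝ) ≤ L * ((subEdgeCount H : ℝ) / (A.ncard : ℝ))

section Graph

open Finset Classical

/-- A graph with many edges on a vertex set `U` has a nonempty subset of `U` on which every
degree is at least half of the average degree. -/
theorem exists_subset_le_card_adj (Γ : SimpleGraph V) (μ : ℝ) (U : Finset V) :
    U.Nonempty →
    2 * μ * (#U : ℝ) ≤ (#((U ×ˢ U).filter fun e => Γ.Adj e.1 e.2) : ℝ) →
    ∃ U' ⊆ U, U'.Nonempty ∧ ∀ v ∈ U', μ ≤ (#(U'.filter (Γ.Adj v)) : ℝ) := by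
  induction U using Finset.strongInduction with
  | H U ih =>
    intro hne h
    by_cases hall : ∀ v ∈ U, μ ≤ (#(U.filter (Γ.Adj v)) : ℝ)
    · exact ⟨U, Subset.rfl, hne, hall⟩
    push Not at hall
    obtain ⟨v, hv, hlt⟩ := hall
    have hsub : ((U ×ˢ U).filter fun e => Γ.Adj e.1 e.2) ⊆
        (((U.erase v) ×ˢ (U.erase v)).filter fun e => Γ.Adj e.1 e.2) ∪
          (({v} ×ˢ U.filter (Γ.Adj v)) ∪ (U.filter (Γ.Adj v) ×ˢ {v})) := by
      rintro ⟨x, y⟩ hxy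
      simp only [mem_filter, mem_product, mem_union, mem_erase, mem_singleton] at hxy ⊢
      by_cases hx : x = v
      · subst hx; tauto
      by_cases hy : y = v
      · subst hy
        have := hxy.2.symm
        tauto
      tauto
    have hcard := (card_le_card hsub).trans ((card_union_le _ _).trans
      (Nat.add_le_add_left (card_union_le _ _) _))
    simp only [card_product, card_singleton, one_mul, mul_one] at hcard
    have hcard' : (#((U ×ˢ U).filter fun e => Γ.Adj e.1 e.2) : ℝ) ≤
        #(((U.erase v) ×ˢ (U.erase v)).filter fun e => Γ.Adj e.1 e.2) +
          (#(U.filter (Γ.Adj v)) + #(U.filter (Γ.Adj v))) := by exact_mod_cast hcard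
    have hc : (#(U.erase v) : ℝ) = #U - 1 := by
      rw [card_erase_of_mem hv, Nat.cast_sub (card_pos.mpr hne)]; simp
    have hstrict : 2 * μ * (#(U.erase v) : ℝ) <
        (#(((U.erase v) ×ˢ (U.erase v)).filter fun e => Γ.Adj e.1 e.2) : ℝ) := by
      rw [hc]; linarith
    have hne' : (U.erase v).Nonempty := by
      by_contra hemp
      rw [not_nonempty_iff_eq_empty] at hemp
      simp [hemp] at hstrict
    obtain ⟨U', hU', h1, h2⟩ := ih _ (erase_ssubset hv) hne' hstrict.le
    exact ⟨U', hU'.trans (erase_subset _ _), h1, h2⟩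

/-- The degrees of a subgraph of a finite graph sum to at most twice its number of edges. -/
theorem sum_subDeg_eq [Fintype V] {G : SimpleGraph V} (H : G.Subgraph) (U : Finset V)
    (hU : ∀ v, v ∈ U ↔ v ∈ H.verts) :
    ∑ v ∈ U, subDeg H v = 2 * subEdgeCount H := by
  have h1 := H.spanningCoe.sum_degrees_eq_twice_card_edges
  have h2 : subEdgeCount H = #H.spanningCoe.edgeFinset := by
    unfold subEdgeCount
    rw [← SimpleGraph.Subgraph.edgeSet_spanningCoe, ← SimpleGraph.coe_edgeFinset,
      Set.ncard_coe_finset]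
  rw [h2, ← h1]
  have h3 : ∀ v, subDeg H v = H.spanningCoe.degree v := by
    intro v
    unfold subDeg
    rw [← SimpleGraph.card_neighborFinset_eq_degree, ← Set.ncard_coe_finset,
      SimpleGraph.coe_neighborFinset]
    rfl
  simp_rw [h3]
  refine sum_subset (subset_univ _) fun v _ hv => ?_
  rw [← h3]
  unfold subDeg
  rw [Set.ncard_eq_zero]
  ext w
  simp only [SimpleGraph.Subgraph.mem_neighborSet, Set.mem_empty_iff_false, iff_false]
  exact fun hadj => hv ((hU v).2 hadj.fst_mem)

/-- A vertex set on which all degrees of `Γ ≤ G` lie between `μ` and `K * μ` induces a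
`K`-almost-regular subgraph of `G`. -/
theorem hasAlmostRegularSubgraph_of_card_adj [Fintype V] {G Γ : SimpleGraph V} (hΓ : Γ ≤ G)
    {K μ : ℝ} (hK : 0 ≤ K) (U : Finset V) (hU : U.Nonempty)
    (hlo : ∀ v ∈ U, μ ≤ (#(U.filter (Γ.Adj v)) : ℝ))
    (hhi : ∀ v ∈ U, (#(U.filter (Γ.Adj v)) : ℝ) ≤ K * μ) :
    HasAlmostRegularSubgraph G K μ := by
  let H : G.Subgraph :=
    { verts := U
      Adj := fun v w => v ∈ U ∧ w ∈ U ∧ Γ.Adj v w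
      adj_sub := fun h => hΓ h.2.2
      edge_vert := fun h => h.1
      symm := ⟨fun v w h => ⟨h.2.1, h.1, h.2.2.symm⟩⟩ }
  have hdeg : ∀ v ∈ U, subDeg H v = #(U.filter (Γ.Adj v)) := by
    intro v hv
    unfold subDeg
    rw [← Set.ncard_coe_finset]
    congr 1
    ext w
    simp [H, SimpleGraph.Subgraph.mem_neighborSet, hv]
  refine ⟨H, ?_, ?_, ?_⟩
  · obtain ⟨v, hv⟩ := hU
    exact ⟨v, hv⟩
  · intro v hv w hw
    have hv' : v ∈ U := hv
    have hw' : w ∈ U := hw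
    rw [hdeg v hv', hdeg w hw']
    exact (hhi v hv').trans (mul_le_mul_of_nonneg_left (hlo w hw') hK)
  · have hsum := sum_subDeg_eq H U (fun v => Iff.rfl)
    have hsum' : (2 * (subEdgeCount H : ℝ)) = ∑ v ∈ U, (subDeg H v : ℝ) := by
      exact_mod_cast hsum.symm
    unfold subAvgDeg
    have hverts : H.verts.ncard = #U := Set.ncard_coe_finset U
    rw [hsum', hverts, le_div_iff₀ (by exact_mod_cast card_pos.mpr hU)]
    calc μ * #U = ∑ _v ∈ U, μ := by rw [sum_const, nsmul_eq_mul, mul_comm]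
      _ ≤ _ := sum_le_sum fun v hv => by rw [hdeg v hv]; exact hlo v hv

theorem sum_sub_mul_sub_mul {ι : Type*} (𝒢 : Finset ι) (κ q : ℝ) (f c : ι → ℝ) :
    ∑ g ∈ 𝒢, (κ - q * f g - κ * c g) = κ * #𝒢 - q * ∑ g ∈ 𝒢, f g - κ * ∑ g ∈ 𝒢, c g := by
  rw [sum_sub_distrib, sum_sub_distrib, mul_sum, mul_sum, sum_const, nsmul_eq_mul,
    mul_comm κ (#𝒢 : ℝ)]

set_option maxHeartbeats 400000 in
/-- Stars `{β g} × N g` that cover few vertices, rarely share a centre and rarely overlap in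
their leaves contain an almost-regular graph. -/
theorem hasAlmostRegularSubgraph_of_stars [Fintype V] {ι : Type*} {G : SimpleGraph V}
    (Z : Finset V) (𝒢 : Finset ι) (β : ι → V) (N : ι → Finset V) (κ : ℕ) (A : Finset V)
    (hβ : ∀ g ∈ 𝒢, β g ∉ Z) (hNZ : ∀ g ∈ 𝒢, N g ⊆ Z) (hNA : ∀ g ∈ 𝒢, N g ⊆ A)
    (hadj : ∀ g ∈ 𝒢, ∀ a ∈ N g, G.Adj (β g) a) (hκ : ∀ g ∈ 𝒢, #(N g) = κ) (hκ0 : 0 < κ)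
    (h : (κ : ℝ) / 8 * (#A + #𝒢) < κ * #𝒢 -
      1 / (8 * κ) * ∑ g ∈ 𝒢, ∑ a ∈ N g, (#(𝒢.filter fun g' => a ∈ N g') : ℝ) -
      κ * ∑ g ∈ 𝒢, (#(𝒢.filter fun g' => g' ≠ g ∧ β g' = β g) : ℝ)) :
    HasAlmostRegularSubgraph G 64 ((κ : ℝ) / 8) := by
  set D : V → ℕ := fun a => #(𝒢.filter fun g' => a ∈ N g') with hD
  set C : ι → ℕ := fun g => #(𝒢.filter fun g' => g' ≠ g ∧ β g' = β g) with hC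
  have hκR : (0 : ℝ) < κ := by exact_mod_cast hκ0
  have hκ8 : (0 : ℝ) < κ / 8 := by positivity
  set 𝒰 := 𝒢.filter fun g => C g = 0 with h𝒰
  set good : ι → Finset V := fun g => (N g).filter fun a => D a ≤ 8 * κ with hgood
  set E : Finset (V × V) := 𝒰.biUnion fun g => ({β g} : Finset V) ×ˢ good g with hE
  have huniq : ∀ g ∈ 𝒰, ∀ g' ∈ 𝒢, β g' = β g → g' = g := by
    intro g hg g' hg' hb
    by_contra hne
    have := (mem_filter.mp hg).2
    rw [hC, card_eq_zero] at this
    have hmem : g' ∈ 𝒢.filter fun g' => g' ≠ g ∧ β g' = β g := mem_filter.mpr ⟨hg', hne, hb⟩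
    rw [this] at hmem
    simp at hmem
  have h𝒰𝒢 : 𝒰 ⊆ 𝒢 := filter_subset _ _
  have hmemE : ∀ b a, (b, a) ∈ E ↔ ∃ g ∈ 𝒰, b = β g ∧ a ∈ N g ∧ D a ≤ 8 * κ := by
    intro b a
    simp only [hE, hgood, mem_biUnion, mem_product, mem_singleton, mem_filter]
  have hEcard : #E = ∑ g ∈ 𝒰, #(good g) := by
    rw [hE, card_biUnion]
    · refine sum_congr rfl fun g _ => ?_
      rw [card_product, card_singleton, one_mul]
    · intro g hg g' hg' hne
      rw [Function.onFun, disjoint_left]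
      rintro ⟨b, a⟩ h1 h2
      simp only [mem_product, mem_singleton] at h1 h2
      exact hne (huniq g' hg' g (h𝒰𝒢 hg) (h1.1.symm.trans h2.1))
  have hgoodcard : ∀ g ∈ 𝒢, (κ : ℝ) - 1 / (8 * κ) * ∑ a ∈ N g, (D a : ℝ) ≤ #(good g) := by
    intro g hg
    have h1 : (#(good g) : ℝ) = ∑ a ∈ N g, if D a ≤ 8 * κ then (1 : ℝ) else 0 := by
      rw [hgood, card_filter]; push_cast; rfl
    have h2 : (κ : ℝ) = ∑ _a ∈ N g, (1 : ℝ) := by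
      rw [sum_const, hκ g hg, nsmul_eq_mul, mul_one]
    rw [h1, mul_sum, sub_le_iff_le_add, ← sum_add_distrib]
    conv_lhs => rw [h2]
    refine sum_le_sum fun a _ => ?_
    split_ifs with hif
    · have : 0 ≤ 1 / (8 * (κ : ℝ)) * D a := by positivity
      linarith
    · rw [zero_add, div_mul_eq_mul_div, one_mul, le_div_iff₀ (by positivity), one_mul]
      push Not at hif
      exact_mod_cast hif.le
  have hE_lower : (κ : ℝ) / 8 * (#A + #𝒢) < #E := by
    refine h.trans_le ?_
    rw [hEcard]
    push_cast
    have h1 : ∑ g ∈ 𝒢, ((κ : ℝ) - 1 / (8 * κ) * ∑ a ∈ N g, (D a : ℝ) - κ * (C g : ℝ)) ≤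
        ∑ g ∈ 𝒰, (#(good g) : ℝ) := by
      rw [h𝒰, sum_filter]
      refine sum_le_sum fun g hg => ?_
      have h3 := hgoodcard g hg
      split_ifs with hif
      · rw [hif]; simpa using h3
      · have h4 : (1 : ℝ) ≤ C g := by exact_mod_cast Nat.one_le_iff_ne_zero.mpr hif
        have h5 : 0 ≤ 1 / (8 * (κ : ℝ)) * ∑ a ∈ N g, (D a : ℝ) :=
          mul_nonneg (by positivity) (sum_nonneg fun a _ => Nat.cast_nonneg _)
        nlinarith
    exact le_trans (le_of_eq (sum_sub_mul_sub_mul _ _ _ _ _).symm) h1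
  obtain ⟨Γ, hΓ⟩ : ∃ Γ : SimpleGraph V, ∀ v w, Γ.Adj v w ↔ (v, w) ∈ E ∨ (w, v) ∈ E := ⟨
    { Adj := fun v w => (v, w) ∈ E ∨ (w, v) ∈ E
      symm := ⟨fun v w h => h.symm⟩
      loopless := ⟨fun v h => by
        have h' : (v, v) ∈ E := h.elim id id
        obtain ⟨g, hg, hb, ha, -⟩ := (hmemE _ _).1 h'
        exact hβ g (h𝒰𝒢 hg) (hb ▸ hNZ g (h𝒰𝒢 hg) ha)⟩ }, fun _ _ => Iff.rfl⟩
  have hΓG : Γ ≤ G := by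
    intro v w hvw
    rcases (hΓ v w).1 hvw with hvw | hvw
    · obtain ⟨g, hg, rfl, ha, -⟩ := (hmemE _ _).1 hvw
      exact hadj g (h𝒰𝒢 hg) w ha
    · obtain ⟨g, hg, rfl, ha, -⟩ := (hmemE _ _).1 hvw
      exact (hadj g (h𝒰𝒢 hg) v ha).symm
  set U : Finset V := A ∪ 𝒢.image β with hU
  have hUcard : (#U : ℝ) ≤ #A + #𝒢 := by
    exact_mod_cast (card_union_le _ _).trans (Nat.add_le_add_left card_image_le _)
  have hsides : ∀ b a, (b, a) ∈ E → b ∉ Z ∧ a ∈ Z ∧ b ∈ U ∧ a ∈ U := by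
    intro b a hba
    obtain ⟨g, hg, rfl, ha, -⟩ := (hmemE _ _).1 hba
    exact ⟨hβ g (h𝒰𝒢 hg), hNZ g (h𝒰𝒢 hg) ha,
      mem_union_right _ (mem_image_of_mem _ (h𝒰𝒢 hg)), mem_union_left _ (hNA g (h𝒰𝒢 hg) ha)⟩
  have hpairs : 2 * #E ≤ #((U ×ˢ U).filter fun e => Γ.Adj e.1 e.2) := by
    have hdisj : Disjoint E (E.map (Equiv.prodComm V V).toEmbedding) := by
      rw [disjoint_left]
      rintro ⟨b, a⟩ h1 h2
      simp only [mem_map_equiv] at h2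
      exact (hsides _ _ h1).1 (hsides _ _ h2).2.1
    have hcard : #(E ∪ E.map (Equiv.prodComm V V).toEmbedding) = 2 * #E := by
      rw [card_union_of_disjoint hdisj, card_map]; ring
    rw [← hcard]
    refine card_le_card fun ⟨x, y⟩ hxy => ?_
    simp only [mem_union, mem_map_equiv] at hxy
    simp only [mem_filter, mem_product]
    rcases hxy with hxy | hxy
    · exact ⟨⟨(hsides _ _ hxy).2.2.1, (hsides _ _ hxy).2.2.2⟩, (hΓ _ _).2 (Or.inl hxy)⟩
    · exact ⟨⟨(hsides _ _ hxy).2.2.2, (hsides _ _ hxy).2.2.1⟩, (hΓ _ _).2 (Or.inr hxy)⟩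
  have hEpos : (0 : ℝ) < #E :=
    lt_of_le_of_lt (mul_nonneg hκ8.le (add_nonneg (Nat.cast_nonneg _) (Nat.cast_nonneg _))) hE_lower
  have hUne : U.Nonempty := by
    obtain ⟨⟨b, a⟩, hba⟩ := card_pos.mp (by exact_mod_cast hEpos : 0 < #E)
    exact ⟨b, (hsides _ _ hba).2.2.1⟩
  obtain ⟨U', -, hU'ne, hU'⟩ := exists_subset_le_card_adj Γ ((κ : ℝ) / 8) U hUne (by
    have h1 : (2 * #E : ℝ) ≤ #((U ×ˢ U).filter fun e => Γ.Adj e.1 e.2) := by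
      exact_mod_cast hpairs
    refine le_trans ?_ h1
    have := mul_le_mul_of_nonneg_left hUcard hκ8.le
    linarith)
  refine hasAlmostRegularSubgraph_of_card_adj hΓG (by norm_num) U' hU'ne hU' fun v hv => ?_
  have hbound : #(U'.filter (Γ.Adj v)) ≤ 8 * κ := by
    have hpos : (0 : ℝ) < #(U'.filter (Γ.Adj v)) :=
      lt_of_lt_of_le hκ8 (hU' v hv)
    obtain ⟨w, hw⟩ := card_pos.mp (by exact_mod_cast hpos : 0 < #(U'.filter (Γ.Adj v)))
    rcases (hΓ _ _).1 (mem_filter.mp hw).2 with hvw | hvw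
    · obtain ⟨g, hg, hb, ha, -⟩ := (hmemE _ _).1 hvw
      have hsub : U'.filter (Γ.Adj v) ⊆ N g := by
        intro y hy
        rcases (hΓ _ _).1 (mem_filter.mp hy).2 with hvy | hvy
        · obtain ⟨g', hg', hb', ha', -⟩ := (hmemE _ _).1 hvy
          rwa [huniq g hg g' (h𝒰𝒢 hg') (hb'.symm.trans hb)] at ha'
        · exact absurd (hsides _ _ hvy).2.1 (hsides _ _ hvw).1
      have := card_le_card hsub
      rw [hκ g (h𝒰𝒢 hg)] at this
      omega
    · obtain ⟨g, hg, hb, ha, hDv⟩ := (hmemE _ _).1 hvw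
      have hsub : U'.filter (Γ.Adj v) ⊆ (𝒢.filter fun g' => v ∈ N g').image β := by
        intro y hy
        rcases (hΓ _ _).1 (mem_filter.mp hy).2 with hvy | hvy
        · exact absurd (hsides _ _ hvw).2.1 (hsides _ _ hvy).1
        · obtain ⟨g', hg', hb', ha', -⟩ := (hmemE _ _).1 hvy
          exact mem_image.mpr ⟨g', mem_filter.mpr ⟨h𝒰𝒢 hg', ha'⟩, hb'.symm⟩
      exact ((card_le_card hsub).trans card_image_le).trans hDv
  have : (#(U'.filter (Γ.Adj v)) : ℝ) ≤ 8 * κ := by exact_mod_cast hbound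
  linarith

end Graph

section Sampling

open Finset Classical

/-- The expectation functional of independent biased coins indexed by `S`, evaluated on
functions of the random set of successful coins. -/
theorem exists_coin_expectation {I : Type*} (S : Finset I) (x : I → ℝ) (h0 : ∀ i ∈ S, 0 ≤ x i)
    (h1 : ∀ i ∈ S, x i ≤ 1) :
    ∃ E : (Finset I → ℝ) →ₗ[ℝ] ℝ, (∀ f, 0 < E f → ∃ Z ⊆ S, 0 < f Z) ∧
      ∀ T ⊆ S, ∀ χ : Finset I → ℝ, (∀ Z, T ⊆ Z → χ Z = 1) → (∀ Z, ¬ T ⊆ Z → χ Z = 0) →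
        E χ = ∏ i ∈ T, x i := by
  refine ⟨∑ Z ∈ S.powerset, ((∏ i ∈ Z, x i) * ∏ i ∈ S \ Z, (1 - x i)) • LinearMap.proj Z,
    fun f hf => ?_, fun T hT χ hχ1 hχ0 => ?_⟩
  · simp only [LinearMap.sum_apply, LinearMap.smul_apply, LinearMap.proj_apply,
      smul_eq_mul] at hf
    obtain ⟨Z, hZ, hpos⟩ := exists_lt_of_sum_lt (by simpa using hf :
      ∑ Z ∈ S.powerset, (0 : ℝ) < ∑ Z ∈ S.powerset,
        ((∏ i ∈ Z, x i) * ∏ i ∈ S \ Z, (1 - x i)) * f Z)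
    rw [mem_powerset] at hZ
    refine ⟨Z, hZ, pos_of_mul_pos_right hpos (mul_nonneg (prod_nonneg fun i hi => h0 i (hZ hi))
      (prod_nonneg fun i hi => ?_))⟩
    have := h1 i (mem_sdiff.mp hi).1
    linarith
  · simp only [LinearMap.sum_apply, LinearMap.smul_apply, LinearMap.proj_apply, smul_eq_mul]
    have hR : ∏ i ∈ T, x i = ∏ i ∈ S, (x i + if i ∈ T then 0 else 1 - x i) := by
      rw [← prod_subset hT (f := fun i => x i + if i ∈ T then 0 else 1 - x i)]
      · exact prod_congr rfl fun i hi => by simp [hi]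
      · intro i _ hi
        simp [hi]
    rw [hR, prod_add]
    refine sum_congr rfl fun Z _ => ?_
    rw [mul_assoc]
    congr 1
    by_cases hTZ : T ⊆ Z
    · rw [hχ1 Z hTZ, mul_one]
      refine prod_congr rfl fun i hi => ?_
      rw [if_neg fun hiT => (mem_sdiff.mp hi).2 (hTZ hiT)]
    · rw [hχ0 Z hTZ, mul_zero]
      obtain ⟨i, hiT, hiZ⟩ := not_subset.mp hTZ
      exact (prod_eq_zero (mem_sdiff.mpr ⟨hT hiT, hiZ⟩) (by simp [hiT])).symm

/-- If a family of stars is built from blocks, and if random sampling of the blocks balances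
the block densities `p`, then some subfamily spans an almost-regular graph. -/
theorem hasAlmostRegularSubgraph_of_blocks [Fintype V] {ι σ : Type*} {G : SimpleGraph V}
    (Z : Finset V) (𝒢 : Finset ι) (β : ι → V) (𝒮 : Finset σ) (F : ι → Finset σ)
    (blk : σ → Finset V) (p : σ → ℝ) (κ k : ℕ) (Δ : ℝ) (h𝒢 : 𝒢.Nonempty)
    (hβ : ∀ g ∈ 𝒢, β g ∉ Z) (hF : ∀ g ∈ 𝒢, F g ⊆ 𝒮)
    (hNZ : ∀ g ∈ 𝒢, ∀ S ∈ F g, blk S ⊆ Z)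
    (hadj : ∀ g ∈ 𝒢, ∀ S ∈ F g, ∀ a ∈ blk S, G.Adj (β g) a)
    (hblk : ∀ S ∈ 𝒮, #(blk S) ≤ k) (hκ : ∀ g ∈ 𝒢, #((F g).biUnion blk) = κ) (hκ2 : 2 ≤ κ)
    (hΔ : 0 < Δ) (hp0 : ∀ S ∈ 𝒮, 0 < p S) (hp1 : ∀ S ∈ 𝒮, p S ≤ 1)
    (hprod : ∀ g ∈ 𝒢, κ / Δ ≤ ∏ S ∈ F g, p S)
    (hcover : k * ∑ S ∈ 𝒮, p S ≤ 3 * (κ / Δ) * #𝒢)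
    (hcodeg : ∀ g ∈ 𝒢, ∀ a ∈ (F g).biUnion blk,
      ∑ g' ∈ 𝒢.filter (fun g' => g' ≠ g ∧ a ∈ (F g').biUnion blk),
        (∏ S ∈ F g ∩ F g', p S)⁻¹ ≤ 3 * Δ)
    (hdisj : ∀ g ∈ 𝒢, ∀ g' ∈ 𝒢, g' ≠ g → β g' = β g → Disjoint (F g) (F g'))
    (hcentre : ∀ g ∈ 𝒢,
      64 * κ * (#(𝒢.filter fun g' => g' ≠ g ∧ β g' = β g) : ℝ) ≤ Δ) :
    HasAlmostRegularSubgraph G 64 ((κ : ℝ) / 8) := by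
  have hκR : (2 : ℝ) ≤ κ := by exact_mod_cast hκ2
  obtain ⟨P, hP⟩ : ∃ P : ℝ, P = κ / Δ := ⟨_, rfl⟩
  have hP0 : 0 < P := by rw [hP]; positivity
  have hPΔ : P * Δ = κ := by rw [hP]; field_simp
  rw [← hP] at hprod hcover
  have hprod0 : ∀ g ∈ 𝒢, 0 < ∏ S ∈ F g, p S := fun g hg => hP0.trans_le (hprod g hg)
  obtain ⟨T, hT⟩ : ∃ T : ι → Finset (σ ⊕ ι), ∀ g, T g = (F g).disjSum {g} := ⟨_, fun _ => rfl⟩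
  obtain ⟨x, hxl, hxr⟩ : ∃ x : σ ⊕ ι → ℝ, (∀ S, x (Sum.inl S) = p S) ∧
      ∀ g, x (Sum.inr g) = P / ∏ S ∈ F g, p S :=
    ⟨Sum.elim p fun g => P / ∏ S ∈ F g, p S, fun _ => rfl, fun _ => rfl⟩
  have hxT : ∀ g ∈ 𝒢, ∏ i ∈ T g, x i = P := by
    intro g hg
    have := (hprod0 g hg).ne'
    simp only [hT, prod_disjSum, hxl, prod_singleton, hxr]
    field_simp
  have hxTT : ∀ g ∈ 𝒢, ∀ g' ∈ 𝒢, g' ≠ g →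
      ∏ i ∈ T g ∪ T g', x i = P ^ 2 * (∏ S ∈ F g ∩ F g', p S)⁻¹ := by
    intro g hg g' hg' hne
    have hinter : T g ∩ T g' = (F g ∩ F g').disjSum ∅ := by
      ext i
      rcases i with S | h
      · simp [hT]
      · simp only [hT, mem_inter, inr_mem_disjSum, mem_singleton, notMem_empty, iff_false,
          not_and]
        rintro rfl h
        exact hne h.symm
    have h1 := prod_union_inter (s₁ := T g) (s₂ := T g') (f := x)
    rw [hxT g hg, hxT g' hg', hinter, prod_disjSum, prod_empty, mul_one] at h1
    simp only [hxl] at h1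
    rw [eq_mul_inv_iff_mul_eq₀ (prod_pos fun S hS =>
      hp0 S (hF g hg (mem_inter.mp hS).1)).ne', h1, sq]
  have hTsub : ∀ g ∈ 𝒢, T g ⊆ 𝒮.disjSum 𝒢 := by
    intro g hg
    rw [hT]
    exact disjSum_mono (hF g hg) (singleton_subset_iff.mpr hg)
  obtain ⟨E, hEpos, hEχ⟩ := exists_coin_expectation (𝒮.disjSum 𝒢) x
    (by
      rintro (S | g) hi
      · rw [hxl]; exact (hp0 S (by simpa using hi)).le
      · have hg : g ∈ 𝒢 := by simpa using hi
        rw [hxr]; exact div_nonneg hP0.le (hprod0 g hg).le)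
    (by
      rintro (S | g) hi
      · rw [hxl]; exact hp1 S (by simpa using hi)
      · have hg : g ∈ 𝒢 := by simpa using hi
        rw [hxr, div_le_one (hprod0 g hg)]; exact hprod g hg)
  obtain ⟨χ, hχ⟩ : ∃ χ : Finset (σ ⊕ ι) → Finset (σ ⊕ ι) → ℝ,
      ∀ T, χ T = fun Z => if T ⊆ Z then 1 else 0 := ⟨_, fun _ => rfl⟩
  have hEχ' : ∀ T ⊆ 𝒮.disjSum 𝒢, E (χ T) = ∏ i ∈ T, x i := fun T hT =>
    hEχ T hT _ (fun Z h => by rw [hχ]; exact if_pos h) (fun Z h => by rw [hχ]; exact if_neg h)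
  obtain ⟨N, hN⟩ : ∃ N : ι → Finset V, ∀ g, N g = (F g).biUnion blk := ⟨_, fun _ => rfl⟩
  simp only [← hN] at hκ hcodeg
  obtain ⟨f, hf⟩ : ∃ f : Finset (σ ⊕ ι) → ℝ, f = (κ : ℝ) • ∑ g ∈ 𝒢, χ (T g)
      - (1 / (8 * κ) : ℝ) • ∑ g ∈ 𝒢, ∑ a ∈ N g, ∑ g' ∈ 𝒢.filter (fun g' => a ∈ N g'),
          χ (T g ∪ T g')
      - (κ : ℝ) • ∑ g ∈ 𝒢, ∑ g' ∈ 𝒢.filter (fun g' => g' ≠ g ∧ β g' = β g), χ (T g ∪ T g')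
      - (κ / 8 : ℝ) • ((k : ℝ) • ∑ S ∈ 𝒮, χ {Sum.inl S} + ∑ g ∈ 𝒢, χ (T g)) := ⟨_, rfl⟩
  have hEf : 0 < E f := by
    have hs1 : ∑ g ∈ 𝒢, E (χ (T g)) = #𝒢 * P := by
      rw [sum_congr rfl fun g hg => (hEχ' _ (hTsub g hg)).trans (hxT g hg), sum_const,
        nsmul_eq_mul]
    have hs2 : ∑ g ∈ 𝒢, ∑ a ∈ N g, ∑ g' ∈ 𝒢.filter (fun g' => a ∈ N g'),
        E (χ (T g ∪ T g')) ≤ #𝒢 * (κ * (P + P ^ 2 * (3 * Δ))) := by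
      rw [← nsmul_eq_mul]
      refine sum_le_card_nsmul _ _ _ fun g hg => ?_
      rw [← hκ g hg, ← nsmul_eq_mul]
      refine sum_le_card_nsmul _ _ _ fun a ha => ?_
      have hmem : g ∈ 𝒢.filter (fun g' => a ∈ N g') := mem_filter.mpr ⟨hg, ha⟩
      rw [← add_sum_erase _ _ hmem, union_self, hEχ' _ (hTsub g hg), hxT g hg]
      have herase : (𝒢.filter fun g' => a ∈ N g').erase g =
          𝒢.filter fun g' => g' ≠ g ∧ a ∈ N g' := by
        ext g'; simp only [mem_erase, mem_filter]; tauto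
      rw [herase]
      have : ∑ g' ∈ 𝒢.filter (fun g' => g' ≠ g ∧ a ∈ N g'), E (χ (T g ∪ T g')) =
          P ^ 2 * ∑ g' ∈ 𝒢.filter (fun g' => g' ≠ g ∧ a ∈ N g'),
            (∏ S ∈ F g ∩ F g', p S)⁻¹ := by
        rw [mul_sum]
        refine sum_congr rfl fun g' hg' => ?_
        obtain ⟨hg'𝒢, hne, -⟩ := mem_filter.mp hg'
        rw [hEχ' _ (union_subset (hTsub g hg) (hTsub g' hg'𝒢)), hxTT g hg g' hg'𝒢 hne]
      rw [this]
      have := mul_le_mul_of_nonneg_left (hcodeg g hg a ha) (sq_nonneg P)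
      linarith
    have hs3 : ∑ g ∈ 𝒢, ∑ g' ∈ 𝒢.filter (fun g' => g' ≠ g ∧ β g' = β g),
        E (χ (T g ∪ T g')) ≤ #𝒢 * (P / 64) := by
      rw [← nsmul_eq_mul]
      refine sum_le_card_nsmul _ _ _ fun g hg => ?_
      have : ∑ g' ∈ 𝒢.filter (fun g' => g' ≠ g ∧ β g' = β g), E (χ (T g ∪ T g')) =
          #(𝒢.filter fun g' => g' ≠ g ∧ β g' = β g) * P ^ 2 := by
        rw [← nsmul_eq_mul, ← sum_const]
        refine sum_congr rfl fun g' hg' => ?_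
        obtain ⟨hg'𝒢, hne, hb⟩ := mem_filter.mp hg'
        rw [hEχ' _ (union_subset (hTsub g hg) (hTsub g' hg'𝒢)), hxTT g hg g' hg'𝒢 hne,
          disjoint_iff_inter_eq_empty.mp (hdisj g hg g' hg'𝒢 hne hb), prod_empty, inv_one,
          mul_one]
      rw [this]
      have h7 := hcentre g hg
      rw [← hPΔ] at h7
      have h8 : 64 * P * (#(𝒢.filter fun g' => g' ≠ g ∧ β g' = β g) : ℝ) ≤ 1 := by
        refine le_of_mul_le_mul_right ?_ hΔ
        linarith
      have := mul_le_mul_of_nonneg_left h8 hP0.le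
      linarith
    have hs4 : k * ∑ S ∈ 𝒮, E (χ {Sum.inl S}) ≤ 3 * P * #𝒢 := by
      rw [sum_congr rfl fun S hS => ?_]
      · exact hcover
      · rw [hEχ' _ (singleton_subset_iff.mpr (by simpa using hS)), prod_singleton, hxl]
    have hEf' : E f = κ * ∑ g ∈ 𝒢, E (χ (T g))
        - (1 / (8 * κ)) * ∑ g ∈ 𝒢, ∑ a ∈ N g, ∑ g' ∈ 𝒢.filter (fun g' => a ∈ N g'),
            E (χ (T g ∪ T g'))
        - κ * ∑ g ∈ 𝒢, ∑ g' ∈ 𝒢.filter (fun g' => g' ≠ g ∧ β g' = β g), E (χ (T g ∪ T g'))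
        - (κ / 8) * (k * ∑ S ∈ 𝒮, E (χ {Sum.inl S}) + ∑ g ∈ 𝒢, E (χ (T g))) := by
      rw [hf]
      simp only [map_sub, map_add, map_smul, map_sum, smul_eq_mul]
    rw [hEf', hs1]
    have hc : (0 : ℝ) < #𝒢 := by exact_mod_cast card_pos.mpr h𝒢
    have h2 := mul_le_mul_of_nonneg_left hs2 (by positivity : (0 : ℝ) ≤ 1 / (8 * κ))
    have h3 := mul_le_mul_of_nonneg_left hs3 (by positivity : (0 : ℝ) ≤ κ)
    have h4 := mul_le_mul_of_nonneg_left hs4 (by positivity : (0 : ℝ) ≤ κ / 8)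
    have h5 : (1 / (8 * κ)) * ((#𝒢 : ℝ) * (κ * (P + P ^ 2 * (3 * Δ)))) =
        #𝒢 * P * (1 / 8 + 3 * κ / 8) := by
      have : P ^ 2 * (3 * Δ) = 3 * P * κ := by rw [← hPΔ]; ring
      rw [this]
      field_simp
    rw [h5] at h2
    have h6 : 0 < (#𝒢 : ℝ) * P := mul_pos hc hP0
    have h7 : (#𝒢 : ℝ) * P * 2 ≤ #𝒢 * P * κ := mul_le_mul_of_nonneg_left hκR h6.le
    linarith
  obtain ⟨Y, -, hY⟩ := hEpos f hEf
  obtain ⟨𝒢', h𝒢'⟩ : ∃ 𝒢' : Finset ι, 𝒢' = 𝒢.filter fun g => T g ⊆ Y := ⟨_, rfl⟩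
  obtain ⟨A', hA'⟩ : ∃ A' : Finset V, A' = (𝒮.filter fun S => Sum.inl S ∈ Y).biUnion blk :=
    ⟨_, rfl⟩
  have hsub : 𝒢' ⊆ 𝒢 := h𝒢' ▸ filter_subset _ _
  refine hasAlmostRegularSubgraph_of_stars Z 𝒢' β N κ A' (fun g hg => hβ g (hsub hg))
    (fun g hg => ?_) (fun g hg => ?_) (fun g hg a ha => ?_) (fun g hg => hκ g (hsub hg))
    (by omega) ?_
  · rw [hN]; exact biUnion_subset.mpr (hNZ g (hsub hg))
  · rw [hN, hA']
    refine biUnion_subset.mpr fun S hS => subset_biUnion_of_mem blk (mem_filter.mpr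
      ⟨hF g (hsub hg) hS, ?_⟩)
    rw [h𝒢', mem_filter, hT] at hg
    exact hg.2 (by simpa using hS)
  · rw [hN, mem_biUnion] at ha
    obtain ⟨S, hS, haS⟩ := ha
    exact hadj g (hsub hg) S hS a haS
  · have hpair : ∀ (q : ι → ι → Prop) [∀ g, DecidablePred (q g)],
        ∑ g ∈ 𝒢', (#(𝒢'.filter (q g)) : ℝ) =
        ∑ g ∈ 𝒢, ∑ g' ∈ 𝒢.filter (q g), χ (T g ∪ T g') Y := by
      intro q _
      conv_lhs => rw [h𝒢', sum_filter]
      refine sum_congr rfl fun g _ => ?_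
      split_ifs with hgY
      · rw [filter_filter, card_filter, sum_filter]
        push_cast
        refine sum_congr rfl fun g' _ => ?_
        by_cases h1 : q g g' <;> by_cases h2 : T g' ⊆ Y <;> simp [h1, h2, hχ, union_subset_iff, hgY]
      · refine (sum_eq_zero fun g' _ => ?_).symm
        simp [hχ, union_subset_iff, hgY]
    have hone : (#𝒢' : ℝ) = ∑ g ∈ 𝒢, χ (T g) Y := by
      rw [h𝒢', card_filter]
      push_cast
      exact sum_congr rfl fun g _ => by rw [hχ]
    have hA'card : (#A' : ℝ) ≤ k * ∑ S ∈ 𝒮, χ {Sum.inl S} Y := by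
      have h1 : #A' ≤ #(𝒮.filter fun S => Sum.inl S ∈ Y) * k := by
        rw [hA']
        exact card_biUnion_le_card_mul _ _ _ fun S hS => hblk S (mem_filter.mp hS).1
      have h2 : (#(𝒮.filter fun S => Sum.inl S ∈ Y) : ℝ) = ∑ S ∈ 𝒮, χ {Sum.inl S} Y := by
        rw [card_filter]
        push_cast
        exact sum_congr rfl fun S _ => by simp [hχ]
      rw [← h2, mul_comm]
      exact_mod_cast h1
    have hdouble : ∑ g ∈ 𝒢', ∑ a ∈ N g, (#(𝒢'.filter fun g' => a ∈ N g') : ℝ) =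
        ∑ g ∈ 𝒢, ∑ a ∈ N g, ∑ g' ∈ 𝒢.filter (fun g' => a ∈ N g'), χ (T g ∪ T g') Y := by
      conv_lhs => rw [h𝒢', sum_filter]
      refine sum_congr rfl fun g _ => ?_
      split_ifs with hgY
      · refine sum_congr rfl fun a _ => ?_
        rw [filter_filter, card_filter, sum_filter]
        push_cast
        refine sum_congr rfl fun g' _ => ?_
        by_cases h1 : a ∈ N g' <;> by_cases h2 : T g' ⊆ Y <;>
          simp [h1, h2, hχ, union_subset_iff, hgY]
      · refine (sum_eq_zero fun a _ => sum_eq_zero fun g' _ => ?_).symm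
        simp [hχ, union_subset_iff, hgY]
    have hfY : f Y = κ * ∑ g ∈ 𝒢, χ (T g) Y
        - (1 / (8 * κ)) * ∑ g ∈ 𝒢, ∑ a ∈ N g, ∑ g' ∈ 𝒢.filter (fun g' => a ∈ N g'),
            χ (T g ∪ T g') Y
        - κ * ∑ g ∈ 𝒢, ∑ g' ∈ 𝒢.filter (fun g' => g' ≠ g ∧ β g' = β g), χ (T g ∪ T g') Y
        - (κ / 8) * (k * ∑ S ∈ 𝒮, χ {Sum.inl S} Y + ∑ g ∈ 𝒢, χ (T g) Y) := by
      rw [hf]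
      simp only [Pi.sub_apply, Pi.add_apply, Pi.smul_apply, Finset.sum_apply, smul_eq_mul]
    rw [hfY, ← hone, ← hdouble, ← hpair fun g g' => g' ≠ g ∧ β g' = β g] at hY
    have := mul_le_mul_of_nonneg_left hA'card (by positivity : (0 : ℝ) ≤ κ / 8)
    linarith

end Sampling

section Bipartition

open Finset Classical

/-- A random bipartition of a graph in which every vertex of `U` has `512 * τ` selected
neighbours keeps many edges of bounded degree on one side. -/
theorem exists_random_bipartition (U : Finset V) (N : V → Finset V) (τ : ℕ) (hτ : 1 ≤ τ)
    (hU : U.Nonempty) (hN : ∀ b ∈ U, N b ⊆ U) (hb : ∀ b ∈ U, b ∉ N b)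
    (hcard : ∀ b ∈ U, #(N b) = 512 * τ) :
    ∃ Z ⊆ U, ∃ M : V → Finset V, (∀ b, M b ⊆ N b ∩ Z) ∧ (∀ b, #(M b) ≤ 2 * τ) ∧
      (τ * #U / 4 + 128 * τ * #Z : ℝ) ≤ ∑ b ∈ U \ Z, (#(M b) : ℝ) := by
  have hτR : (1 : ℝ) ≤ τ := by exact_mod_cast hτ
  obtain ⟨E, hEpos, hEχ⟩ := exists_coin_expectation U (fun _ => (1 / 512 : ℝ))
    (fun _ _ => by norm_num) (fun _ _ => by norm_num)
  obtain ⟨χ, hχ⟩ : ∃ χ : Finset V → Finset V → ℝ,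
      ∀ T, χ T = fun Z => if T ⊆ Z then 1 else 0 := ⟨_, fun _ => rfl⟩
  have hE : ∀ T ⊆ U, E (χ T) = (1 / 512 : ℝ) ^ #T := fun T hT => by
    rw [hEχ T hT _ (fun Z h => by rw [hχ]; exact if_pos h) (fun Z h => by rw [hχ]; exact if_neg h),
      prod_const]
  obtain ⟨f, hf⟩ : ∃ f : Finset V → ℝ, f = ∑ b ∈ U, (∑ a ∈ N b, χ {a} - ∑ a ∈ N b, χ {b, a}
      - (1 / (8 * τ) : ℝ) • ∑ a ∈ N b, ∑ a' ∈ N b, χ {a, a'})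
      - (128 * τ : ℝ) • ∑ b ∈ U, χ {b} - (τ * #U / 4 : ℝ) • χ ∅ := ⟨_, rfl⟩
  have hEf : 0 < E f := by
    have hEf' : E f = ∑ b ∈ U, (∑ a ∈ N b, E (χ {a}) - ∑ a ∈ N b, E (χ {b, a})
        - (1 / (8 * τ) : ℝ) * ∑ a ∈ N b, ∑ a' ∈ N b, E (χ {a, a'}))
        - (128 * τ : ℝ) * ∑ b ∈ U, E (χ {b}) - (τ * #U / 4 : ℝ) * E (χ ∅) := by
      rw [hf]
      simp only [map_sub, map_smul, map_sum, smul_eq_mul]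
    have h1 : ∀ a ∈ U, E (χ {a}) = 1 / 512 := fun a ha => by
      rw [hE _ (singleton_subset_iff.mpr ha), card_singleton, pow_one]
    have h2 : ∀ a ∈ U, ∀ a' ∈ U, a ≠ a' → E (χ {a, a'}) = (1 / 512) ^ 2 :=
      fun a ha a' ha' hne => by
        rw [hE _ (insert_subset ha (singleton_subset_iff.mpr ha')), card_pair hne]
    have hterm : ∀ b ∈ U, (7 / 10 * τ : ℝ) ≤ ∑ a ∈ N b, E (χ {a})
        - ∑ a ∈ N b, E (χ {b, a})
        - (1 / (8 * τ) : ℝ) * ∑ a ∈ N b, ∑ a' ∈ N b, E (χ {a, a'}) := by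
      intro b hbU
      have hc : (#(N b) : ℝ) = 512 * τ := by exact_mod_cast hcard b hbU
      have e1 : ∑ a ∈ N b, E (χ {a}) = τ := by
        rw [sum_congr rfl fun a ha => h1 a (hN b hbU ha), sum_const, nsmul_eq_mul, hc]
        ring
      have e2 : ∑ a ∈ N b, E (χ {b, a}) = τ / 512 := by
        rw [sum_congr rfl fun a ha => h2 b hbU a (hN b hbU ha) fun h => hb b hbU (h ▸ ha),
          sum_const, nsmul_eq_mul, hc]
        ring
      have e3 : ∑ a ∈ N b, ∑ a' ∈ N b, E (χ {a, a'}) ≤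
          512 * τ * (1 / 512 + 512 * τ * (1 / 512) ^ 2) := by
        rw [← hc, ← nsmul_eq_mul]
        refine sum_le_card_nsmul _ _ _ fun a ha => ?_
        have haU := hN b hbU ha
        rw [← add_sum_erase _ _ ha, pair_eq_singleton, h1 a haU,
          sum_congr rfl fun a' ha' => h2 a haU a' (hN b hbU (mem_of_mem_erase ha'))
            (ne_of_mem_erase ha').symm, sum_const, nsmul_eq_mul]
        have : (#((N b).erase a) : ℝ) ≤ #(N b) := by
          exact_mod_cast card_le_card (erase_subset _ _)
        linarith
      rw [e1, e2]
      have e4 := mul_le_mul_of_nonneg_left e3 (by positivity : (0 : ℝ) ≤ 1 / (8 * τ))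
      have e5 : (1 / (8 * τ) : ℝ) * (512 * τ * (1 / 512 + 512 * τ * (1 / 512) ^ 2)) =
          1 / 8 + τ / 8 := by field_simp
      rw [e5] at e4
      linarith
    have hU0 : (0 : ℝ) < #U := by exact_mod_cast card_pos.mpr hU
    have hsum := sum_le_sum hterm
    have hs1 : ∑ b ∈ U, E (χ {b}) = #U / 512 := by
      rw [sum_congr rfl h1, sum_const, nsmul_eq_mul]; ring
    have hs2 : E (χ ∅) = 1 := by rw [hE _ (empty_subset _)]; simp
    rw [hEf', hs1, hs2]
    rw [sum_const, nsmul_eq_mul] at hsum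
    have := mul_pos hU0 (lt_of_lt_of_le one_pos hτR)
    linarith
  obtain ⟨Z, hZ, hfZ⟩ := hEpos f hEf
  have hM : ∀ b, ∃ M ⊆ N b ∩ Z, #M = min #(N b ∩ Z) (2 * τ) := fun b =>
    exists_subset_card_eq (min_le_left _ _)
  choose M hM hMcard using hM
  refine ⟨Z, hZ, M, hM, fun b => (hMcard b).trans_le (min_le_right _ _), ?_⟩
  have hfZ' : f Z = ∑ b ∈ U, (∑ a ∈ N b, χ {a} Z - ∑ a ∈ N b, χ {b, a} Z
      - (1 / (8 * τ) : ℝ) * ∑ a ∈ N b, ∑ a' ∈ N b, χ {a, a'} Z)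
      - (128 * τ : ℝ) * ∑ b ∈ U, χ {b} Z - (τ * #U / 4 : ℝ) * χ ∅ Z := by
    rw [hf]
    simp only [Pi.sub_apply, Pi.smul_apply, Finset.sum_apply, smul_eq_mul]
  have hx : ∀ b, ∑ a ∈ N b, χ {a} Z = #(N b ∩ Z) := by
    intro b
    simp [hχ, ← filter_mem_eq_inter]
  have hxx : ∀ b, ∑ a ∈ N b, ∑ a' ∈ N b, χ {a, a'} Z = (#(N b ∩ Z) : ℝ) ^ 2 := by
    intro b
    rw [sq, ← hx, sum_mul_sum]
    refine sum_congr rfl fun a _ => sum_congr rfl fun a' _ => ?_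
    by_cases h1 : a ∈ Z <;> by_cases h2 : a' ∈ Z <;> simp [hχ, h1, h2, insert_subset_iff]
  have hxb : ∀ b, ∑ a ∈ N b, χ {b, a} Z = if b ∈ Z then (#(N b ∩ Z) : ℝ) else 0 := by
    intro b
    split_ifs with h
    · rw [← hx]
      exact sum_congr rfl fun a _ => by simp [hχ, h, insert_subset_iff]
    · exact sum_eq_zero fun a _ => by simp [hχ, h, insert_subset_iff]
  have hZc : ∑ b ∈ U, χ {b} Z = #Z := by
    have : Z = U.filter (· ∈ Z) := by
      ext v; simp only [mem_filter]; exact ⟨fun h => ⟨hZ h, h⟩, fun h => h.2⟩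
    conv_rhs => rw [this, card_filter]
    push_cast
    exact sum_congr rfl fun b _ => by simp [hχ]
  have h0 : χ ∅ Z = 1 := by simp [hχ]
  rw [hfZ', hZc, h0] at hfZ
  have hsd : ∑ b ∈ U \ Z, (#(M b) : ℝ) = ∑ b ∈ U, if b ∈ Z then 0 else (#(M b) : ℝ) := by
    rw [sdiff_eq_filter, sum_filter]
    exact sum_congr rfl fun b _ => by split_ifs <;> simp_all
  have hterm : ∀ b ∈ U, (∑ a ∈ N b, χ {a} Z - ∑ a ∈ N b, χ {b, a} Z
      - (1 / (8 * τ) : ℝ) * ∑ a ∈ N b, ∑ a' ∈ N b, χ {a, a'} Z) ≤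
      if b ∈ Z then 0 else (#(M b) : ℝ) := by
    intro b _
    rw [hx, hxb, hxx]
    have hsq : 0 ≤ (1 / (8 * τ) : ℝ) * (#(N b ∩ Z) : ℝ) ^ 2 := by positivity
    split_ifs with h
    · linarith
    · rw [hMcard]
      rcases min_cases #(N b ∩ Z) (2 * τ) with ⟨h1, -⟩ | ⟨h1, -⟩
      · rw [h1]; linarith
      · rw [h1]
        push_cast
        have : (#(N b ∩ Z) : ℝ) - 1 / (8 * τ) * (#(N b ∩ Z) : ℝ) ^ 2 =
            2 * τ - 1 / (8 * τ) * (#(N b ∩ Z) - 4 * τ) ^ 2 := by field_simp; ring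
        have h2 : 0 ≤ 1 / (8 * τ) * ((#(N b ∩ Z) : ℝ) - 4 * τ) ^ 2 := by positivity
        linarith
  have := sum_le_sum hterm
  rw [← hsd] at this
  linarith

/-- A version of `exists_random_bipartition` in which all degrees on the other side are
large. -/
theorem exists_bipartition_of_card_eq (U : Finset V) (N : V → Finset V) (τ : ℕ) (hτ : 1 ≤ τ)
    (hU : U.Nonempty) (hN : ∀ b ∈ U, N b ⊆ U) (hb : ∀ b ∈ U, b ∉ N b)
    (hcard : ∀ b ∈ U, #(N b) = 512 * τ) :
    ∃ Z B : Finset V, B ⊆ U ∧ Disjoint B Z ∧ ∃ M : V → Finset V,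
      (∀ b, M b ⊆ N b) ∧ (∀ b, M b ⊆ Z) ∧ (∀ b, #(M b) ≤ 2 * τ) ∧
      (∀ b, ∀ a ∈ M b, 128 * τ ≤ #(B.filter fun b' => a ∈ M b')) ∧
      (τ * #U / 4 : ℝ) ≤ ∑ b ∈ B, (#(M b) : ℝ) := by
  obtain ⟨Z, hZ, M, hM, hMcard, hsum⟩ := exists_random_bipartition U N τ hτ hU hN hb hcard
  obtain ⟨D, hD⟩ : ∃ D : V → ℕ, ∀ a, D a = #((U \ Z).filter fun b' => a ∈ M b') :=
    ⟨_, fun _ => rfl⟩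
  refine ⟨Z, U \ Z, sdiff_subset, sdiff_disjoint, fun b => (M b).filter fun a => 128 * τ ≤ D a,
    fun b => (filter_subset _ _).trans ((hM b).trans inter_subset_left),
    fun b => (filter_subset _ _).trans ((hM b).trans inter_subset_right),
    fun b => (card_le_card (filter_subset _ _)).trans (hMcard b), fun b a ha => ?_, ?_⟩
  · have ha' := (mem_filter.mp ha).2
    refine ha'.trans (le_of_eq ?_)
    rw [hD]
    congr 1
    ext b'
    simp only [mem_filter, ha', and_true]
  · have hsplit : ∀ b, (#(M b) : ℝ) = #((M b).filter fun a => 128 * τ ≤ D a) +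
        #((M b).filter fun a => ¬ 128 * τ ≤ D a) := fun b => by
      exact_mod_cast (card_filter_add_card_filter_not _).symm
    have hlow : ∑ b ∈ U \ Z, (#((M b).filter fun a => ¬ 128 * τ ≤ D a) : ℝ) ≤
        128 * τ * #Z := by
      have h1 : ∑ b ∈ U \ Z, #((M b).filter fun a => ¬ 128 * τ ≤ D a) =
          ∑ a ∈ Z, if 128 * τ ≤ D a then 0 else D a := by
        have h2 : ∀ b, #((M b).filter fun a => ¬ 128 * τ ≤ D a) =
            ∑ a ∈ Z, if a ∈ M b ∧ ¬ 128 * τ ≤ D a then 1 else 0 := fun b => by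
          rw [← card_filter]
          congr 1
          ext a
          simp only [mem_filter]
          exact ⟨fun h => ⟨(mem_inter.mp (hM b h.1)).2, h⟩, fun h => h.2⟩
        simp_rw [h2]
        rw [sum_comm]
        refine sum_congr rfl fun a _ => ?_
        split_ifs with h
        · exact sum_eq_zero fun b _ => by simp [h]
        · conv_rhs => rw [hD, card_filter]
          exact sum_congr rfl fun b _ => by simp only [h, not_false_eq_true, and_true]
      have h3 : ∑ a ∈ Z, (if 128 * τ ≤ D a then 0 else D a) ≤ #Z * (128 * τ) := by
        rw [← smul_eq_mul]
        refine sum_le_card_nsmul _ _ _ fun a _ => ?_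
        split_ifs with h <;> omega
      have h4 := h1.trans_le h3
      calc _ = ((∑ b ∈ U \ Z, #((M b).filter fun a => ¬ 128 * τ ≤ D a) : ℕ) : ℝ) := by
              push_cast; rfl
        _ ≤ ((#Z * (128 * τ) : ℕ) : ℝ) := by exact_mod_cast h4
        _ = _ := by push_cast; ring
    rw [sum_congr rfl fun b _ => hsplit b, sum_add_distrib] at hsum
    linarith

end Bipartition

section Extraction

open Finset Classical

/-- If all singletons are heavy, then every large set without heavy `(j + 1)`-subsets contains,
for some `k ≤ j`, many disjoint heavy `k`-sets which do not extend to heavy `(k + 1)`-sets within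
their union. -/
theorem exists_disjoint_heavy (heavy : Finset V → Prop) (hone : ∀ a, heavy {a}) (t K : ℕ) (j : ℕ)
    (hj : j ≤ t) (U : Finset V) (hU : ∀ S ⊆ U, #S = j + 1 → ¬ heavy S)
    (hcard : j * (t * K) + 1 ≤ #U) :
    ∃ k, 1 ≤ k ∧ k ≤ j ∧ ∃ F : Finset (Finset V), #F = K ∧ (∀ S ∈ F, S ⊆ U) ∧
      (∀ S ∈ F, #S = k) ∧ (∀ S ∈ F, heavy S) ∧ (F : Set (Finset V)).PairwiseDisjoint id ∧
      ∀ S ∈ F, ∀ a ∈ F.biUnion id, a ∉ S → ¬ heavy (insert a S) := by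
  induction j generalizing U with
  | zero =>
    obtain ⟨a, ha⟩ := card_pos.mp (by omega : 0 < #U)
    exact absurd (hone a) (hU {a} (singleton_subset_iff.mpr ha) (card_singleton a))
  | succ j ih =>
    obtain ⟨𝒟, h𝒟⟩ : ∃ 𝒟 : Finset (Finset (Finset V)), ∀ M, M ∈ 𝒟 ↔
        M ⊆ (powersetCard (j + 1) U).filter heavy ∧ (M : Set (Finset V)).PairwiseDisjoint id :=
      ⟨((powersetCard (j + 1) U).filter heavy).powerset.filter
        fun M => (M : Set (Finset V)).PairwiseDisjoint id, fun M => by simp⟩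
    have hne : 𝒟.Nonempty := ⟨∅, (h𝒟 _).2 ⟨empty_subset _, by simp⟩⟩
    obtain ⟨M, hM, hmax⟩ := exists_max_image 𝒟 card hne
    obtain ⟨hMs, hMd⟩ := (h𝒟 M).1 hM
    have hmem : ∀ S ∈ M, S ⊆ U ∧ #S = j + 1 ∧ heavy S := fun S hS => by
      have := hMs hS
      rw [mem_filter, mem_powersetCard] at this
      exact ⟨this.1.1, this.1.2, this.2⟩
    by_cases hK : K ≤ #M
    · obtain ⟨F, hFM, hF⟩ := exists_subset_card_eq hK
      refine ⟨j + 1, by omega, le_rfl, F, hF, fun S hS => (hmem S (hFM hS)).1,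
        fun S hS => (hmem S (hFM hS)).2.1, fun S hS => (hmem S (hFM hS)).2.2,
        hMd.subset (by exact_mod_cast hFM), fun S hS a ha haS => hU _ ?_ ?_⟩
      · obtain ⟨S', hS', haS'⟩ := mem_biUnion.mp ha
        exact insert_subset ((hmem S' (hFM hS')).1 haS') (hmem S (hFM hS)).1
      · rw [card_insert_of_notMem haS, (hmem S (hFM hS)).2.1]
    · have hcM : #(M.biUnion id) ≤ t * K := by
        refine (card_biUnion_le_card_mul _ _ (j + 1) fun S hS => (hmem S hS).2.1.le).trans ?_
        rw [mul_comm]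
        exact Nat.mul_le_mul hj (by omega)
      have hsd := le_card_sdiff (M.biUnion id) U
      obtain ⟨k, hk1, hkj, F, h1, h2, h3, h4, h5, h6⟩ := ih (by omega) (U \ M.biUnion id)
        (fun S hS hSc hSh => by
          have hdisj : ∀ S' ∈ M, Disjoint S S' := fun S' hS' => by
            refine disjoint_left.mpr fun a ha ha' => ?_
            exact (mem_sdiff.mp (hS ha)).2 (mem_biUnion.mpr ⟨S', hS', ha'⟩)
          have hSM : S ∉ M := fun hSM => by
            have := hdisj S hSM
            rw [disjoint_self, bot_eq_empty] at this
            simp [this] at hSc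
          have : insert S M ∈ 𝒟 := by
            refine (h𝒟 _).2 ⟨insert_subset ?_ hMs, ?_⟩
            · exact mem_filter.mpr ⟨mem_powersetCard.mpr ⟨hS.trans sdiff_subset, hSc⟩, hSh⟩
            · rw [coe_insert]
              exact hMd.insert fun S' hS' _ => hdisj S' (by exact_mod_cast hS')
          have := hmax _ this
          rw [card_insert_of_notMem hSM] at this
          omega)
        (by
          have : (j + 1) * (t * K) = j * (t * K) + t * K := by ring
          omega)
      exact ⟨k, hk1, by omega, F, h1, fun S hS => (h2 S hS).trans sdiff_subset, h3, h4, h5, h6⟩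

/-- Stars whose leaves have nearly the same degree contain an almost-regular graph. -/
theorem hasAlmostRegularSubgraph_of_degrees_le [Fintype V] {G : SimpleGraph V} (Z : Finset V)
    (𝒢 : Finset (V × Finset V)) (K : ℕ) (Δ : ℝ) (hK : 2 ≤ K) (h𝒢 : 𝒢.Nonempty)
    (hβ : ∀ g ∈ 𝒢, g.1 ∉ Z) (hZ : ∀ g ∈ 𝒢, g.2 ⊆ Z) (hcard : ∀ g ∈ 𝒢, #g.2 = K)
    (hadj : ∀ g ∈ 𝒢, ∀ a ∈ g.2, G.Adj g.1 a)
    (hdisj : ∀ g ∈ 𝒢, ∀ g' ∈ 𝒢, g' ≠ g → g'.1 = g.1 → Disjoint g.2 g'.2)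
    (hdeg : ∀ a, (#(𝒢.filter fun g => a ∈ g.2) : ℝ) ≤ Δ)
    (hcentre : ∀ b, 64 * K * (#(𝒢.filter fun g => g.1 = b) : ℝ) ≤ Δ)
    (hcover : #(𝒢.biUnion Prod.snd) * Δ ≤ 3 * K * #𝒢) :
    HasAlmostRegularSubgraph G 64 ((K : ℝ) / 8) := by
  have hKR : (2 : ℝ) ≤ K := by exact_mod_cast hK
  have hKΔ : (K : ℝ) ≤ Δ := by
    obtain ⟨g, hg⟩ := h𝒢
    have h1 : (1 : ℝ) ≤ #(𝒢.filter fun g' => g'.1 = g.1) := by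
      have : 0 < #(𝒢.filter fun g' => g'.1 = g.1) := card_pos.mpr ⟨g, by simp [hg]⟩
      exact_mod_cast this
    have h2 := hcentre g.1
    nlinarith
  have hΔ : 0 < Δ := by linarith
  refine hasAlmostRegularSubgraph_of_blocks Z 𝒢 Prod.fst (𝒢.biUnion Prod.snd) Prod.snd
    (fun a => {a}) (fun _ => 1) K 1 Δ h𝒢 hβ (fun g hg => subset_biUnion_of_mem Prod.snd hg)
    (fun g hg a ha => singleton_subset_iff.mpr (hZ g hg ha))
    (fun g hg a ha a' ha' => by rw [mem_singleton.mp ha']; exact hadj g hg a ha)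
    (fun a _ => (card_singleton a).le)
    (fun g hg => by rw [biUnion_singleton_eq_self]; exact hcard g hg) hK hΔ
    (fun _ _ => one_pos) (fun _ _ => le_rfl) (fun g _ => ?_) ?_ (fun g hg a _ => ?_)
    (fun g hg g' hg' hne hb => hdisj g hg g' hg' hne hb) (fun g _ => ?_)
  · rw [prod_const_one, div_le_one hΔ]; exact hKΔ
  · simp only [sum_const, nsmul_eq_mul, mul_one, Nat.cast_one, one_mul]
    rw [← mul_div_assoc, div_mul_eq_mul_div, le_div_iff₀ hΔ]
    exact hcover
  · simp only [prod_const_one, inv_one, sum_const, nsmul_eq_mul, mul_one,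
      biUnion_singleton_eq_self]
    have h1 : #(𝒢.filter fun g' => g' ≠ g ∧ a ∈ g'.2) ≤ #(𝒢.filter fun g' => a ∈ g'.2) :=
      card_le_card fun g' h => by
        rw [mem_filter] at h ⊢
        exact ⟨h.1, h.2.2⟩
    have h1' : (#(𝒢.filter fun g' => g' ≠ g ∧ a ∈ g'.2) : ℝ) ≤
        #(𝒢.filter fun g' => a ∈ g'.2) := by exact_mod_cast h1
    have h2 := hdeg a
    linarith
  · refine le_trans ?_ (hcentre g.1)
    refine mul_le_mul_of_nonneg_left ?_ (by positivity)
    have h1 : #(𝒢.filter fun g' => g' ≠ g ∧ g'.1 = g.1) ≤ #(𝒢.filter fun g' => g'.1 = g.1) :=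
      card_le_card fun g' h => by
        rw [mem_filter] at h ⊢
        exact ⟨h.1, h.2.2⟩
    exact_mod_cast h1

end Extraction

section HighDegree

open Finset Classical

/-- Stars whose leaf sets contain many blocks of size `k`, such that blocks rarely extend to
common `(k + 1)`-sets and few stars share `t` leaves, contain an almost-regular graph. -/
theorem hasAlmostRegularSubgraph_of_block_codegrees [Fintype V] {G : SimpleGraph V} (Z : Finset V)
    (𝒢 : Finset (V × Finset V)) (F : V × Finset V → Finset (Finset V)) (t k K K' : ℕ)
    (Δ ρ Λ : ℝ) (ht : 1 ≤ t) (hk : 1 ≤ k) (hK : 2 ≤ K) (hkK : k * K ≤ K') (hΔ : 0 < Δ)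
    (h𝒢 : 𝒢.Nonempty) (hβ : ∀ g ∈ 𝒢, g.1 ∉ Z) (hZ : ∀ g ∈ 𝒢, g.2 ⊆ Z)
    (hcard : ∀ g ∈ 𝒢, #g.2 = K') (hadj : ∀ g ∈ 𝒢, ∀ a ∈ g.2, G.Adj g.1 a)
    (hdisj : ∀ g ∈ 𝒢, ∀ g' ∈ 𝒢, g' ≠ g → g'.1 = g.1 → Disjoint g.2 g'.2)
    (hdeg : ∀ a, (#(𝒢.filter fun g => a ∈ g.2) : ℝ) ≤ Δ)
    (hcentre : ∀ b, 64 * K' * (#(𝒢.filter fun g => g.1 = b) : ℝ) ≤ Δ)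
    (hFcard : ∀ g ∈ 𝒢, #(F g) = K) (hFsub : ∀ g ∈ 𝒢, ∀ S ∈ F g, S ⊆ g.2)
    (hFk : ∀ g ∈ 𝒢, ∀ S ∈ F g, #S = k)
    (hFdisj : ∀ g ∈ 𝒢, (F g : Set (Finset V)).PairwiseDisjoint id)
    (hext : ∀ g ∈ 𝒢, ∀ S ∈ F g, ∀ a ∈ (F g).biUnion id, a ∉ S →
      (#(𝒢.filter fun g' => insert a S ⊆ g'.2) : ℝ) ≤ Λ)
    (hfree : ∀ T : Finset V, #T = t → #(𝒢.filter fun g => T ⊆ g.2) ≤ t)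
    (hcov : #(𝒢.biUnion F) * (ρ * Δ) ≤ 2 * K * #𝒢) (hρ0 : 0 < ρ) (hρ1 : ρ ≤ 1)
    (hΔK : 2 * (t * K' ^ t : ℝ) ≤ Δ * ρ ^ K) (hΛ : 2 * (K * Λ) ≤ Δ * ρ ^ t) :
    HasAlmostRegularSubgraph G 64 ((k * K : ℕ) / 8 : ℝ) := by
  obtain ⟨c, hc⟩ : ∃ c : Finset V → ℕ, ∀ S, c S = #(𝒢.filter fun g => S ∈ F g) :=
    ⟨_, fun _ => rfl⟩
  obtain ⟨p, hp⟩ : ∃ p : Finset V → ℝ, ∀ S, p S = max (c S / Δ) ρ := ⟨_, fun _ => rfl⟩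
  have hpρ : ∀ S, ρ ≤ p S := fun S => by rw [hp]; exact le_max_right _ _
  have hp0 : ∀ S, 0 < p S := fun S => hρ0.trans_le (hpρ S)
  have hκcard : ∀ g ∈ 𝒢, #((F g).biUnion id) = k * K := fun g hg => by
    rw [card_biUnion (hFdisj g hg)]
    simp only [id]
    rw [sum_const_nat (hFk g hg), hFcard g hg, mul_comm]
  have hSne : ∀ g ∈ 𝒢, ∀ S ∈ F g, S.Nonempty := fun g hg S hS => by
    rw [← card_pos, hFk g hg S hS]; omega
  have hpow : ∀ J : Finset (Finset V), ρ ^ #J ≤ ∏ S ∈ J, p S := fun J => by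
    rw [← prod_const]
    exact prod_le_prod (fun _ _ => hρ0.le) fun S _ => hpρ S
  have hinv : ∀ J : Finset (Finset V), ∀ m, #J ≤ m → (∏ S ∈ J, p S)⁻¹ ≤ (ρ ^ m)⁻¹ :=
    fun J m hm => inv_anti₀ (pow_pos hρ0 m)
      ((pow_le_pow_of_le_one hρ0.le hρ1 hm).trans (hpow J))
  have hsubset : ∀ g ∈ 𝒢, ∀ a ∈ (F g).biUnion id, a ∈ g.2 := fun g hg a ha => by
    obtain ⟨S, hS, haS⟩ := mem_biUnion.mp ha
    exact hFsub g hg S hS haS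
  have hκY : ((k * K : ℕ) : ℝ) ≤ 2 * (t * K' ^ t : ℝ) := by
    have h1 : K' ≤ K' ^ t := Nat.le_self_pow (by omega) K'
    have h2 : k * K ≤ 2 * (t * K' ^ t) := by nlinarith
    exact_mod_cast h2
  have hkR : (1 : ℝ) ≤ k := by exact_mod_cast hk
  refine hasAlmostRegularSubgraph_of_blocks Z 𝒢 Prod.fst (𝒢.biUnion F) F id p (k * K) k Δ h𝒢 hβ
    (fun g hg => subset_biUnion_of_mem F hg) (fun g hg S hS => (hFsub g hg S hS).trans (hZ g hg))
    (fun g hg S hS a ha => hadj g hg a (hFsub g hg S hS ha)) (fun S hS => ?_) hκcard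
    (by nlinarith) hΔ (fun S _ => hp0 S) (fun S hS => ?_) (fun g hg => ?_) ?_ (fun g hg a ha => ?_)
    (fun g hg g' hg' hne hb => ?_) (fun g _ => ?_)
  · obtain ⟨g, hg, hS⟩ := mem_biUnion.mp hS
    exact (hFk g hg S hS).le
  · obtain ⟨g, hg, hS⟩ := mem_biUnion.mp hS
    obtain ⟨a, ha⟩ := hSne g hg S hS
    rw [hp]
    refine max_le ?_ hρ1
    rw [div_le_one hΔ]
    refine le_trans ?_ (hdeg a)
    rw [hc]
    have : #(𝒢.filter fun g => S ∈ F g) ≤ #(𝒢.filter fun g => a ∈ g.2) :=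
      card_le_card fun g' h => by
        rw [mem_filter] at h ⊢
        exact ⟨h.1, hFsub g' h.1 S h.2 ha⟩
    exact_mod_cast this
  · rw [div_le_iff₀ hΔ, mul_comm (∏ S ∈ F g, p S)]
    refine hκY.trans (hΔK.trans (mul_le_mul_of_nonneg_left ?_ hΔ.le))
    rw [← hFcard g hg]
    exact hpow _
  · have h1 : ∑ S ∈ 𝒢.biUnion F, (c S : ℝ) = K * #𝒢 := by
      have h2 : ∑ S ∈ 𝒢.biUnion F, c S = ∑ g ∈ 𝒢, #(F g) := by
        simp_rw [hc, card_filter]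
        rw [sum_comm]
        refine sum_congr rfl fun g hg => ?_
        rw [← card_filter]
        congr 1
        ext S
        simp only [mem_filter, mem_biUnion]
        exact ⟨fun h => h.2, fun h => ⟨⟨g, hg, h⟩, h⟩⟩
      rw [sum_const_nat hFcard] at h2
      rw [mul_comm]
      exact_mod_cast h2
    have h3 : ∑ S ∈ 𝒢.biUnion F, p S ≤ (∑ S ∈ 𝒢.biUnion F, (c S : ℝ)) / Δ +
        #(𝒢.biUnion F) * ρ := by
      rw [sum_div, ← nsmul_eq_mul, ← sum_const, ← sum_add_distrib]
      refine sum_le_sum fun S _ => ?_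
      rw [hp]
      exact max_le_add_of_nonneg (by positivity) hρ0.le
    rw [h1] at h3
    have h4 : (#(𝒢.biUnion F) : ℝ) * ρ ≤ 2 * K * #𝒢 / Δ := by
      rw [le_div_iff₀ hΔ, mul_assoc]; exact hcov
    push_cast
    calc (k : ℝ) * ∑ S ∈ 𝒢.biUnion F, p S ≤ k * (K * #𝒢 / Δ + 2 * K * #𝒢 / Δ) :=
          mul_le_mul_of_nonneg_left (by linarith) (by positivity)
      _ = _ := by ring
  · obtain ⟨Sa, hSa, haSa⟩ := mem_biUnion.mp ha
    simp only [id] at haSa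
    obtain ⟨X1, hX1⟩ : ∃ X : Finset (V × Finset V), X = 𝒢.filter fun g' => a ∈ g'.2 := ⟨_, rfl⟩
    obtain ⟨X2, hX2⟩ : ∃ X : Finset (V × Finset V), X = 𝒢.filter fun g' => Sa ∈ F g' := ⟨_, rfl⟩
    obtain ⟨X3, hX3⟩ : ∃ X : Finset (V × Finset V), X =
      ((F g).filter fun S => a ∉ S).biUnion fun S => 𝒢.filter fun g' => insert a S ⊆ g'.2 :=
        ⟨_, rfl⟩
    obtain ⟨X4, hX4⟩ : ∃ X : Finset (V × Finset V), X =
      (powersetCard t g.2).biUnion fun T => 𝒢.filter fun g' => T ⊆ g'.2 := ⟨_, rfl⟩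
    have hX1c : (#X1 : ℝ) ≤ Δ := by rw [hX1]; exact hdeg a
    have hX2c : (#X2 : ℝ) * (p Sa)⁻¹ ≤ Δ := by
      rw [hX2, ← hc, ← div_eq_mul_inv, div_le_iff₀ (hp0 Sa), mul_comm, ← div_le_iff₀ hΔ, hp]
      exact le_max_left _ _
    have hX3c : (#X3 : ℝ) ≤ K * Λ := by
      have h1 : (#X3 : ℝ) ≤ ∑ S ∈ (F g).filter (fun S => a ∉ S),
          (#(𝒢.filter fun g' => insert a S ⊆ g'.2) : ℝ) := by
        rw [hX3]
        exact_mod_cast card_biUnion_le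
      have h2 : ∀ S ∈ (F g).filter (fun S => a ∉ S),
          (#(𝒢.filter fun g' => insert a S ⊆ g'.2) : ℝ) ≤ Λ := fun S hS =>
        hext g hg S (mem_filter.mp hS).1 a ha (mem_filter.mp hS).2
      have h3 : ∀ S ∈ F g, 0 ≤ Λ ∨ a ∈ S := fun S hS => by
        by_cases h : a ∈ S
        · exact Or.inr h
        · exact Or.inl ((Nat.cast_nonneg _).trans (h2 S (mem_filter.mpr ⟨hS, h⟩)))
      have hΛ0 : 0 ≤ Λ := by
        obtain ⟨S, hS, hne⟩ := exists_mem_ne (by rw [hFcard g hg]; omega : 1 < #(F g)) Sa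
        rcases h3 S hS with h | h
        · exact h
        · exact absurd haSa (disjoint_left.mp (hFdisj g hg hS hSa hne) h)
      refine h1.trans ((sum_le_card_nsmul _ _ _ h2).trans ?_)
      rw [nsmul_eq_mul]
      refine mul_le_mul_of_nonneg_right ?_ hΛ0
      rw [← hFcard g hg]
      exact_mod_cast card_le_card (filter_subset _ _)
    have hX4c : (#X4 : ℝ) ≤ t * K' ^ t := by
      have h1 : #X4 ≤ #(powersetCard t g.2) * t := by
        rw [hX4]
        exact card_biUnion_le_card_mul _ _ _ fun T hT => hfree T (mem_powersetCard.mp hT).2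
      rw [card_powersetCard, hcard g hg] at h1
      have h2 : #X4 ≤ t * K' ^ t := by
        rw [mul_comm]
        exact h1.trans (Nat.mul_le_mul_right _ (Nat.choose_le_pow K' t))
      exact_mod_cast h2
    have hbound : ∀ g' ∈ 𝒢.filter (fun g' => g' ≠ g ∧ a ∈ (F g').biUnion id),
        (∏ S ∈ F g ∩ F g', p S)⁻¹ ≤ (if g' ∈ X1 then 1 else 0) +
          (if g' ∈ X2 then (p Sa)⁻¹ else 0) + (if g' ∈ X3 then (ρ ^ t)⁻¹ else 0) +
          (if g' ∈ X4 then (ρ ^ K)⁻¹ else 0) := by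
      intro g' hg'
      obtain ⟨hg'𝒢, -, hag'⟩ := mem_filter.mp hg'
      have hn1 : (0 : ℝ) ≤ if g' ∈ X1 then 1 else 0 := by split_ifs <;> norm_num
      have hn2 : (0 : ℝ) ≤ if g' ∈ X2 then (p Sa)⁻¹ else 0 := by
        split_ifs
        · exact (inv_pos.mpr (hp0 Sa)).le
        · exact le_rfl
      have hn3 : (0 : ℝ) ≤ if g' ∈ X3 then (ρ ^ t)⁻¹ else 0 := by split_ifs <;> positivity
      have hn4 : (0 : ℝ) ≤ if g' ∈ X4 then (ρ ^ K)⁻¹ else 0 := by split_ifs <;> positivity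
      by_cases hJ : F g ∩ F g' ⊆ {Sa}
      · rcases subset_singleton_iff.mp hJ with hJ | hJ
        · have : g' ∈ X1 := by rw [hX1]; exact mem_filter.mpr ⟨hg'𝒢, hsubset g' hg'𝒢 a hag'⟩
          rw [if_pos this] at hn1 ⊢
          rw [hJ, prod_empty, inv_one]
          linarith
        · have h1 : Sa ∈ F g ∩ F g' := by rw [hJ]; exact mem_singleton_self _
          have : g' ∈ X2 := by
            rw [hX2]; exact mem_filter.mpr ⟨hg'𝒢, (mem_inter.mp h1).2⟩
          rw [if_pos this] at hn2 ⊢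
          rw [hJ, prod_singleton]
          linarith
      · by_cases hJt : #(F g ∩ F g') ≤ t
        · obtain ⟨S, hS, hne⟩ := not_subset.mp hJ
          obtain ⟨hS1, hS2⟩ := mem_inter.mp hS
          have haS : a ∉ S := fun h => disjoint_left.mp
            (hFdisj g hg hS1 hSa (by simpa using hne)) h haSa
          have : g' ∈ X3 := by
            rw [hX3]
            exact mem_biUnion.mpr ⟨S, mem_filter.mpr ⟨hS1, haS⟩, mem_filter.mpr ⟨hg'𝒢,
              insert_subset (hsubset g' hg'𝒢 a hag') (hFsub g' hg'𝒢 S hS2)⟩⟩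
          rw [if_pos this] at hn3 ⊢
          have := hinv _ t hJt
          linarith
        · have h1 : t ≤ #((F g ∩ F g').biUnion id) := by
            rw [card_biUnion ((hFdisj g hg).subset (by exact_mod_cast inter_subset_left))]
            simp only [id]
            rw [sum_const_nat fun S hS => hFk g hg S (mem_inter.mp hS).1]
            nlinarith
          obtain ⟨T, hT, hTc⟩ := exists_subset_card_eq h1
          have : g' ∈ X4 := by
            rw [hX4]
            refine mem_biUnion.mpr ⟨T, mem_powersetCard.mpr ⟨fun v hv => ?_, hTc⟩,
              mem_filter.mpr ⟨hg'𝒢, fun v hv => ?_⟩⟩ <;>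
            obtain ⟨S, hS, hvS⟩ := mem_biUnion.mp (hT hv)
            · exact hFsub g hg S (mem_inter.mp hS).1 hvS
            · exact hFsub g' hg'𝒢 S (mem_inter.mp hS).2 hvS
          rw [if_pos this] at hn4 ⊢
          have := hinv (F g ∩ F g') K
            ((card_le_card inter_subset_left).trans (hFcard g hg).le)
          linarith
    have hcount : ∀ X : Finset (V × Finset V), ∀ r : ℝ, 0 ≤ r →
        ∑ g' ∈ 𝒢.filter (fun g' => g' ≠ g ∧ a ∈ (F g').biUnion id),
          (if g' ∈ X then r else 0) ≤ #X * r := fun X r hr => by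
      rw [← sum_filter, sum_const, nsmul_eq_mul]
      refine mul_le_mul_of_nonneg_right ?_ hr
      exact_mod_cast card_le_card fun g' h => (mem_filter.mp h).2
    have hsum := sum_le_sum hbound
    have e1 := hcount X1 1 zero_le_one
    have e2 := hcount X2 _ (inv_pos.mpr (hp0 Sa)).le
    have e3 := hcount X3 _ (inv_pos.mpr (pow_pos hρ0 t)).le
    have e4 := hcount X4 _ (inv_pos.mpr (pow_pos hρ0 K)).le
    have f3 : (#X3 : ℝ) * (ρ ^ t)⁻¹ ≤ Δ / 2 := by
      rw [← div_eq_mul_inv, div_le_iff₀ (pow_pos hρ0 t)]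
      linarith
    have f4 : (#X4 : ℝ) * (ρ ^ K)⁻¹ ≤ Δ / 2 := by
      rw [← div_eq_mul_inv, div_le_iff₀ (pow_pos hρ0 K)]
      linarith
    rw [sum_add_distrib, sum_add_distrib, sum_add_distrib] at hsum
    have hfinal := hsum.trans (by linarith : _ ≤ 3 * Δ)
    refine le_trans (le_of_eq (sum_congr ?_ fun g' _ => congrArg _ (prod_congr ?_ fun _ _ => rfl)))
      hfinal
    · ext; simp only [mem_filter]
    · ext; simp only [mem_inter]
  · refine disjoint_left.mpr fun S hS hS' => ?_
    obtain ⟨a, ha⟩ := hSne g hg S hS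
    exact disjoint_left.mp (hdisj g hg g' hg' hne hb) (hFsub g hg S hS ha)
      (hFsub g' hg' S hS' ha)
  · refine le_trans ?_ (hcentre g.1)
    have h2 : ((k * K : ℕ) : ℝ) ≤ K' := by exact_mod_cast hkK
    refine mul_le_mul (mul_le_mul_of_nonneg_left h2 (by norm_num)) (Nat.cast_le.mpr ?_)
      (Nat.cast_nonneg _) (by positivity)
    refine card_le_card fun g' h => ?_
    simp only [mem_filter] at h ⊢
    exact ⟨h.1, h.2.2⟩

end HighDegree

section HighWindow

open Finset Classical

theorem HasAlmostRegularSubgraph.mono {G : SimpleGraph V} {K c c' : ℝ}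
    (h : HasAlmostRegularSubgraph G K c) (hc : c' ≤ c) : HasAlmostRegularSubgraph G K c' := by
  obtain ⟨H, h1, h2, h3⟩ := h
  exact ⟨H, h1, h2, hc.trans h3⟩

/-- In a `K_{t,t}`-free graph, at most `t` stars share a common set of `t` leaves. -/
theorem KkkFree.card_filter_subset_le {G : SimpleGraph V} {t : ℕ} (hfree : KkkFree G t)
    (ht : 1 ≤ t) (Z : Finset V) (𝒢 : Finset (V × Finset V)) (hβ : ∀ g ∈ 𝒢, g.1 ∉ Z)
    (hZ : ∀ g ∈ 𝒢, g.2 ⊆ Z) (hadj : ∀ g ∈ 𝒢, ∀ a ∈ g.2, G.Adj g.1 a)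
    (hdisj : ∀ g ∈ 𝒢, ∀ g' ∈ 𝒢, g' ≠ g → g'.1 = g.1 → Disjoint g.2 g'.2)
    (T : Finset V) (hT : #T = t) : #(𝒢.filter fun g => T ⊆ g.2) ≤ t := by
  by_contra! hlt
  obtain ⟨v, hv⟩ : T.Nonempty := by rw [← card_pos]; omega
  have hinj : Set.InjOn Prod.fst (𝒢.filter fun g => T ⊆ g.2 : Set (V × Finset V)) := by
    intro g hg g' hg' hgg'
    obtain ⟨h1, h2⟩ := mem_filter.mp (mem_coe.mp hg)
    obtain ⟨h1', h2'⟩ := mem_filter.mp (mem_coe.mp hg')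
    by_contra hne
    exact disjoint_left.mp (hdisj g h1 g' h1' (Ne.symm hne) hgg'.symm) (h2 hv) (h2' hv)
  have hcard : t ≤ #((𝒢.filter fun g => T ⊆ g.2).image Prod.fst) := by
    rw [card_image_of_injOn (by simpa using hinj)]
    exact hlt.le
  obtain ⟨S, hS, hSt⟩ := exists_subset_card_eq hcard
  have hmem : ∀ u ∈ S, ∃ g ∈ 𝒢, T ⊆ g.2 ∧ g.1 = u := fun u hu => by
    obtain ⟨g, hg, hgu⟩ := mem_image.mp (hS hu)
    exact ⟨g, (mem_filter.mp hg).1, (mem_filter.mp hg).2, hgu⟩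
  refine hfree ⟨S, T, disjoint_left.mpr fun u hu hu' => ?_, hSt, hT, fun u hu w hw => ?_⟩
  · obtain ⟨g, hg, hTg, rfl⟩ := hmem u hu
    exact hβ g hg (hZ g hg (hTg hu'))
  · obtain ⟨g, hg, hTg, rfl⟩ := hmem u hu
    exact hadj g hg w (hTg hw)

/-- Stars in a `K_{t,t}`-free graph contain an almost-regular graph if the degrees of most leaves
are close to their maximum `Δ` and `Δ` is large. -/
theorem KkkFree.hasAlmostRegularSubgraph_of_high_degrees [Fintype V] {G : SimpleGraph V} {t : ℕ}
    (hfree : KkkFree G t) (Z : Finset V)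
    (𝒢 : Finset (V × Finset V)) (K K' : ℕ) (Δ Y : ℝ) (R : ℕ → ℝ)
    (ht : 2 ≤ t) (hK : 2 ≤ K) (hK' : K' = t * (t * K)) (hY : Y = t * K' ^ t) (hΔ : 0 < Δ)
    (h𝒢 : 𝒢.Nonempty) (hβ : ∀ g ∈ 𝒢, g.1 ∉ Z) (hZ : ∀ g ∈ 𝒢, g.2 ⊆ Z)
    (hcard : ∀ g ∈ 𝒢, #g.2 = K') (hadj : ∀ g ∈ 𝒢, ∀ a ∈ g.2, G.Adj g.1 a)
    (hdisj : ∀ g ∈ 𝒢, ∀ g' ∈ 𝒢, g' ≠ g → g'.1 = g.1 → Disjoint g.2 g'.2)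
    (hdeg : ∀ a, (#(𝒢.filter fun g => a ∈ g.2) : ℝ) ≤ Δ)
    (hcentre : ∀ b, 64 * K' * (#(𝒢.filter fun g => g.1 = b) : ℝ) ≤ Δ)
    (hR : ∀ k, 1 ≤ R k) (hcover : #(𝒢.biUnion Prod.snd) * Δ ≤ R 1 * K' * #𝒢)
    (hR1 : ∀ k, 1 ≤ k → k < t → 2 * K * (R k * Y) ^ t ≤ R (k + 1))
    (hR2 : ∀ k, 1 ≤ k → k < t → 2 * Y * (R k * Y) ^ K ≤ Δ)
    (hR3 : t * R t < Δ) : HasAlmostRegularSubgraph G 64 (K / 8) := by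
  have hfreeT := hfree.card_filter_subset_le (by omega) Z 𝒢 hβ hZ hadj hdisj
  have htR : (2 : ℝ) ≤ t := by exact_mod_cast ht
  have hKR : (2 : ℝ) ≤ K := by exact_mod_cast hK
  have hR0 : ∀ k, 0 < R k := fun k => zero_lt_one.trans_le (hR k)
  have hK'1 : 1 ≤ K' := by
    rw [hK']
    exact Nat.mul_pos (by omega) (Nat.mul_pos (by omega) (by omega))
  have hK'R : (1 : ℝ) ≤ K' := by exact_mod_cast hK'1
  have hYK : ∀ k ≤ t, (t : ℝ) * K' ^ k ≤ Y := fun k hk => by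
    rw [hY]
    exact mul_le_mul_of_nonneg_left (pow_le_pow_right₀ hK'R hk) (by linarith)
  have hY1 : 1 ≤ Y := by
    have := hYK 0 (by omega)
    rw [pow_zero] at this
    linarith
  obtain ⟨heavy, hheavy⟩ : ∃ heavy : Finset V → Prop, ∀ S, heavy S ↔ (#S = 1 ∨
      Δ ≤ #(𝒢.filter fun g => S ⊆ g.2) * R #S) := ⟨_, fun _ => Iff.rfl⟩
  have hexists : ∀ g ∈ 𝒢, ∃ k, ∃ F : Finset (Finset V), (1 ≤ k ∧ k ≤ t - 1) ∧ #F = K ∧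
      (∀ S ∈ F, S ⊆ g.2) ∧ (∀ S ∈ F, #S = k) ∧ (∀ S ∈ F, heavy S) ∧
      (F : Set (Finset V)).PairwiseDisjoint id ∧
      ∀ S ∈ F, ∀ a ∈ F.biUnion id, a ∉ S → ¬heavy (insert a S) := by
    intro g hg
    have hlight : ∀ S ⊆ g.2, #S = t - 1 + 1 → ¬heavy S := fun S hS hSt hh => by
      have hSt' : #S = t := by omega
      rw [hheavy, hSt'] at hh
      rcases hh with hh | hh
      · omega
      · have h1 : (#(𝒢.filter fun g => S ⊆ g.2) : ℝ) ≤ t := by exact_mod_cast hfreeT S hSt'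
        have := mul_le_mul_of_nonneg_right h1 (hR0 t).le
        linarith
    have hlarge : (t - 1) * (t * K) + 1 ≤ #g.2 := by
      rw [hcard g hg, hK']
      obtain ⟨s, rfl⟩ : ∃ s, t = s + 1 := ⟨t - 1, by omega⟩
      simp only [Nat.add_sub_cancel]
      nlinarith [Nat.mul_pos (by omega : 0 < s + 1) (by omega : 0 < K)]
    obtain ⟨k, hk1, hk2, F, h⟩ := exists_disjoint_heavy heavy
      (fun a => (hheavy _).mpr (Or.inl (card_singleton a))) t K (t - 1) (by omega) g.2 hlight hlarge
    exact ⟨k, F, ⟨hk1, hk2⟩, h⟩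
  choose! κ F hκ hFcard hFsub hFk hFheavy hFdisj hFext using hexists
  obtain ⟨k, hk, hpop⟩ := exists_le_card_fiber_of_nsmul_le_card_of_maps_to
    (s := 𝒢) (t := Icc 1 (t - 1)) (f := κ) (b := (#𝒢 / t : ℝ))
    (fun g hg => mem_Icc.mpr (hκ g hg)) ⟨1, mem_Icc.mpr ⟨le_rfl, by omega⟩⟩ (by
      rw [Nat.card_Icc, nsmul_eq_mul, Nat.add_sub_cancel, mul_div_assoc', div_le_iff₀ (by linarith),
        mul_comm]
      refine mul_le_mul_of_nonneg_left ?_ (Nat.cast_nonneg _)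
      exact_mod_cast Nat.sub_le t 1)
  obtain ⟨hk1, hkt⟩ := mem_Icc.mp hk
  obtain ⟨ℋ, hℋ⟩ : ∃ ℋ : Finset (V × Finset V), ℋ = 𝒢.filter fun g => κ g = k := ⟨_, rfl⟩
  have hmem : ∀ g ∈ ℋ, g ∈ 𝒢 ∧ κ g = k := fun g hg => by
    rw [hℋ] at hg; exact mem_filter.mp hg
  have hsub : ℋ ⊆ 𝒢 := fun g hg => (hmem g hg).1
  have hpop' : (#𝒢 : ℝ) ≤ t * #ℋ := by
    rw [div_le_iff₀ (by linarith), mul_comm] at hpop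
    rw [hℋ]
    exact hpop
  have hℋne : ℋ.Nonempty := by
    rw [nonempty_iff_ne_empty]
    rintro h
    rw [h, card_empty, Nat.cast_zero, mul_zero] at hpop'
    have : 0 < #𝒢 := card_pos.mpr h𝒢
    have : (0 : ℝ) < #𝒢 := by exact_mod_cast this
    linarith
  have hfilter : ∀ (P : V × Finset V → Prop) [DecidablePred P],
      (#(ℋ.filter P) : ℝ) ≤ #(𝒢.filter P) := fun P _ => by
    exact_mod_cast card_le_card (filter_subset_filter _ hsub)
  have hRY : 1 ≤ R k * Y := one_le_mul_of_one_le_of_one_le (hR k) hY1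
  have hRY0 : 0 < R k * Y := zero_lt_one.trans_le hRY
  have hcount : #(ℋ.biUnion F) * Δ ≤ R k * K' ^ k * #𝒢 := by
    rcases Nat.eq_or_lt_of_le hk1 with rfl | hk2
    · have h1 : #(ℋ.biUnion F) ≤ #(𝒢.biUnion Prod.snd) := by
        have h2 : ℋ.biUnion F ⊆ (𝒢.biUnion Prod.snd).image fun a => {a} := fun S hS => by
          obtain ⟨g, hg, hSg⟩ := mem_biUnion.mp hS
          obtain ⟨hg, hκg⟩ := hmem g hg
          obtain ⟨a, ha⟩ := card_eq_one.mp ((hFk g hg S hSg).trans hκg)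
          refine mem_image.mpr ⟨a, mem_biUnion.mpr ⟨g, hg, hFsub g hg S hSg ?_⟩, ha.symm⟩
          rw [ha]
          exact mem_singleton_self a
        exact (card_le_card h2).trans card_image_le
      have h1' : (#(ℋ.biUnion F) : ℝ) ≤ #(𝒢.biUnion Prod.snd) := by exact_mod_cast h1
      rw [pow_one]
      exact (mul_le_mul_of_nonneg_right h1' hΔ.le).trans hcover
    · have h1 : ∀ S ∈ ℋ.biUnion F, #S = k ∧ Δ ≤ #(𝒢.filter fun g => S ⊆ g.2) * R k :=
        fun S hS => by
          obtain ⟨g, hg, hSg⟩ := mem_biUnion.mp hS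
          obtain ⟨hg, hκg⟩ := hmem g hg
          have hSk := (hFk g hg S hSg).trans hκg
          have h2 := hFheavy g hg S hSg
          rw [hheavy, hSk] at h2
          exact ⟨hSk, h2.resolve_left (by omega)⟩
      have h2 : ∑ S ∈ ℋ.biUnion F, #(𝒢.filter fun g => S ⊆ g.2) ≤ #𝒢 * K' ^ k := by
        simp_rw [card_filter]
        rw [sum_comm, ← smul_eq_mul]
        refine sum_le_card_nsmul _ _ _ fun g hg => ?_
        rw [← card_filter]
        refine le_trans (card_le_card fun S hS => ?_)
          (((card_powersetCard k g.2).trans_le (Nat.choose_le_pow _ k)).trans_eq (by rw [hcard g hg]))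
        obtain ⟨hS1, hS2⟩ := mem_filter.mp hS
        exact mem_powersetCard.mpr ⟨hS2, (h1 S hS1).1⟩
      have h2' : ∑ S ∈ ℋ.biUnion F, (#(𝒢.filter fun g => S ⊆ g.2) : ℝ) ≤ #𝒢 * K' ^ k := by
        exact_mod_cast h2
      calc #(ℋ.biUnion F) * Δ = #(ℋ.biUnion F) • Δ := (nsmul_eq_mul _ _).symm
        _ ≤ ∑ S ∈ ℋ.biUnion F, (#(𝒢.filter fun g => S ⊆ g.2) : ℝ) * R k :=
          card_nsmul_le_sum _ _ _ fun S hS => (h1 S hS).2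
        _ ≤ #𝒢 * K' ^ k * R k := by
          rw [← sum_mul]
          exact mul_le_mul_of_nonneg_right h2' (hR0 k).le
        _ = _ := by ring
  have hkK : k * K ≤ K' := by
    rw [hK', ← mul_assoc]
    exact Nat.mul_le_mul_right _ ((by omega : k ≤ t).trans (Nat.le_mul_self t))
  have hdeg' : ∀ a, (#(ℋ.filter fun g => a ∈ g.2) : ℝ) ≤ Δ := fun a =>
    (hfilter _).trans (hdeg a)
  have hcentre' : ∀ b, 64 * K' * (#(ℋ.filter fun g => g.1 = b) : ℝ) ≤ Δ := fun b =>
    (mul_le_mul_of_nonneg_left (hfilter _) (by positivity)).trans (hcentre b)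
  have hext : ∀ g ∈ ℋ, ∀ S ∈ F g, ∀ a ∈ (F g).biUnion id, a ∉ S →
      (#(ℋ.filter fun g' => insert a S ⊆ g'.2) : ℝ) ≤ Δ / R (k + 1) := by
    intro g hg S hS a ha haS
    have h1 := hFext g (hsub hg) S hS a ha haS
    have h2 : #(insert a S) = k + 1 := by
      rw [card_insert_of_notMem haS, hFk g (hsub hg) S hS, (hmem g hg).2]
    rw [hheavy, h2, not_or, not_le] at h1
    rw [le_div_iff₀ (hR0 _)]
    exact (mul_le_mul_of_nonneg_right (hfilter _) (hR0 _).le).trans h1.2.le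
  have hfreeT' : ∀ T : Finset V, #T = t → #(ℋ.filter fun g => T ⊆ g.2) ≤ t := fun T hT =>
    (card_le_card (filter_subset_filter _ hsub)).trans (hfreeT T hT)
  have hcov : #(ℋ.biUnion F) * ((R k * Y)⁻¹ * Δ) ≤ 2 * K * #ℋ := by
    have h1 : (t : ℝ) * K' ^ k ≤ Y := hYK k (by omega)
    have h2 : (#(ℋ.biUnion F) : ℝ) * ((R k * Y)⁻¹ * Δ) ≤ #ℋ := by
      rw [mul_left_comm, inv_mul_le_iff₀ hRY0]
      calc _ ≤ R k * K' ^ k * #𝒢 := hcount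
        _ ≤ R k * K' ^ k * (t * #ℋ) :=
          mul_le_mul_of_nonneg_left hpop' (mul_nonneg (hR0 k).le (by positivity))
        _ = R k * (t * K' ^ k) * #ℋ := by ring
        _ ≤ R k * Y * #ℋ := mul_le_mul_of_nonneg_right
          (mul_le_mul_of_nonneg_left h1 (hR0 k).le) (Nat.cast_nonneg _)
    refine h2.trans ?_
    nlinarith [(Nat.cast_nonneg #ℋ : (0 : ℝ) ≤ #ℋ)]
  have hΔK : 2 * (t * K' ^ t : ℝ) ≤ Δ * (R k * Y)⁻¹ ^ K := by
    rw [← hY, inv_pow, ← div_eq_mul_inv, le_div_iff₀ (pow_pos hRY0 K)]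
    exact hR2 k hk1 (by omega)
  have hΛ : 2 * (K * (Δ / R (k + 1))) ≤ Δ * (R k * Y)⁻¹ ^ t := by
    rw [inv_pow, ← div_eq_mul_inv, le_div_iff₀ (pow_pos hRY0 t)]
    have h1 := hR1 k hk1 (by omega)
    calc 2 * (K * (Δ / R (k + 1))) * (R k * Y) ^ t
        = (2 * K * (R k * Y) ^ t) * (Δ / R (k + 1)) := by ring
      _ ≤ R (k + 1) * (Δ / R (k + 1)) :=
        mul_le_mul_of_nonneg_right h1 (div_nonneg hΔ.le (hR0 _).le)
      _ = Δ := mul_div_cancel₀ _ (hR0 _).ne'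
  have hK'' : (K : ℝ) / 8 ≤ ((k * K : ℕ) : ℝ) / 8 := by
    have h1 : K ≤ k * K := Nat.le_mul_of_pos_left K hk1
    have h2 : (K : ℝ) ≤ (k * K : ℕ) := by exact_mod_cast h1
    linarith
  have hmain := hasAlmostRegularSubgraph_of_block_codegrees Z ℋ F t k K K' Δ (R k * Y)⁻¹
    (Δ / R (k + 1)) (by omega) hk1 hK hkK hΔ hℋne (fun g hg => hβ g (hsub hg))
    (fun g hg => hZ g (hsub hg)) (fun g hg => hcard g (hsub hg)) (fun g hg => hadj g (hsub hg))
    (fun g hg g' hg' => hdisj g (hsub hg) g' (hsub hg')) hdeg' hcentre'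
    (fun g hg => hFcard g (hsub hg)) (fun g hg => hFsub g (hsub hg))
    (fun g hg S hS => (hFk g (hsub hg) S hS).trans (hmem g hg).2)
    (fun g hg => hFdisj g (hsub hg)) hext hfreeT' hcov (inv_pos.mpr hRY0)
    (inv_le_one_of_one_le₀ hRY) hΔK hΛ
  exact hmain.mono hK''

end HighWindow

section Windows

open Finset Classical

/-- The integers up to `X` split into few windows, each of which is either a singleton or an
interval `[L, L + h)` with `N ≤ h + 1 ≤ L / q`. -/
theorem exists_windows (q N X : ℕ) (hq : 1 ≤ q) (hN : 1 ≤ N) :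
    ∃ key : ℕ → ℕ × ℕ, #((range (X + 1)).image key) ≤ 8 * q * (N + Nat.log 2 X + 1) ∧
      ∀ w, ∃ L h, (∀ x, key x = w → L ≤ x ∧ x < L + h) ∧
        (h = 1 ∨ (h + 1) * q ≤ L ∧ N ≤ h + 1) := by
  obtain ⟨μ, hμ1, hμ2⟩ : ∃ μ, 2 * q ≤ 2 ^ μ ∧ 2 ^ μ ≤ 4 * q := by
    refine ⟨Nat.log 2 (2 * q) + 1, (Nat.lt_pow_succ_log_self (by norm_num) _).le, ?_⟩
    have := Nat.pow_log_le_self 2 (by omega : 2 * q ≠ 0)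
    rw [pow_succ]
    omega
  obtain ⟨ν, hν1, hν2⟩ : ∃ ν, N ≤ 2 ^ ν ∧ 2 ^ ν ≤ 2 * N := by
    refine ⟨Nat.log 2 N + 1, (Nat.lt_pow_succ_log_self (by norm_num) _).le, ?_⟩
    have := Nat.pow_log_le_self 2 (by omega : N ≠ 0)
    rw [pow_succ]
    omega
  obtain ⟨key, hkey⟩ : ∃ key : ℕ → ℕ × ℕ, ∀ x, key x =
      if x < 2 ^ (μ + ν) then (0, x) else (Nat.log 2 x + 1, x / 2 ^ (Nat.log 2 x - μ)) :=
    ⟨_, fun _ => rfl⟩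
  refine ⟨key, ?_, fun w => ?_⟩
  · have hsub : (range (X + 1)).image key ⊆ ({0} ×ˢ range (2 ^ (μ + ν))) ∪
        (((range (Nat.log 2 X + 1)).image Nat.succ) ×ˢ range (2 ^ (μ + 1))) := by
      intro w hw
      obtain ⟨x, hx, rfl⟩ := mem_image.mp hw
      rw [mem_range] at hx
      rw [hkey]
      split_ifs with h
      · exact mem_union_left _ (mem_product.mpr ⟨mem_singleton_self _, mem_range.mpr h⟩)
      · refine mem_union_right _ (mem_product.mpr ⟨mem_image.mpr ⟨Nat.log 2 x, ?_, rfl⟩, ?_⟩)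
        · have := Nat.log_mono_right (b := 2) (by omega : x ≤ X)
          exact mem_range.mpr (by omega)
        · have h0 : x ≠ 0 := by
            have := Nat.pos_of_ne_zero (pow_ne_zero (μ + ν) (by norm_num : (2 : ℕ) ≠ 0))
            omega
          have h1 : μ + ν ≤ Nat.log 2 x :=
            (Nat.le_log_iff_pow_le (by norm_num) h0).mpr (not_lt.mp h)
          rw [mem_range, Nat.div_lt_iff_lt_mul (by positivity), ← pow_add]
          have h2 : μ + 1 + (Nat.log 2 x - μ) = Nat.log 2 x + 1 := by omega
          rw [h2]
          exact Nat.lt_pow_succ_log_self (by norm_num) _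
    refine (card_le_card hsub).trans ((card_union_le _ _).trans ?_)
    rw [card_product, card_product, card_singleton, card_range, card_range,
      card_image_of_injective _ Nat.succ_injective, card_range, pow_add, pow_succ]
    nlinarith [Nat.mul_le_mul hμ2 hν2, Nat.mul_le_mul hμ2 (le_refl (Nat.log 2 X + 1))]
  · rcases Nat.eq_zero_or_pos w.1 with hw | hw
    · refine ⟨w.2, 1, fun x hx => ?_, Or.inl rfl⟩
      rw [hkey] at hx
      split_ifs at hx with h
      · rw [← hx]
        exact ⟨le_rfl, Nat.lt_succ_self _⟩
      · rw [← hx] at hw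
        exact absurd hw (Nat.succ_ne_zero _)
    · by_cases hex : ∃ x, key x = w
      · obtain ⟨y, hy⟩ := hex
        have hcase : ∀ x, key x = w → 2 ^ (μ + ν) ≤ x ∧ Nat.log 2 x + 1 = w.1 ∧
            x / 2 ^ (Nat.log 2 x - μ) = w.2 := fun x hx => by
          rw [hkey] at hx
          split_ifs at hx with h
          · rw [← hx] at hw
            exact absurd hw (lt_irrefl 0)
          · rw [← hx]
            exact ⟨not_lt.mp h, rfl, rfl⟩
        obtain ⟨e, he⟩ : ∃ e, w.1 = e + 1 := ⟨w.1 - 1, by omega⟩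
        have hcase' : ∀ x, key x = w → w.2 * 2 ^ (e - μ) ≤ x ∧
            x < w.2 * 2 ^ (e - μ) + 2 ^ (e - μ) := fun x hx => by
          obtain ⟨h1, h2, h3⟩ := hcase x hx
          have h4 : Nat.log 2 x = e := by omega
          rw [h4] at h3
          rw [← h3]
          refine ⟨Nat.div_mul_le_self _ _, ?_⟩
          have := Nat.lt_div_mul_add (a := x) (b := 2 ^ (e - μ)) (by positivity)
          exact this
        refine ⟨w.2 * 2 ^ (e - μ), 2 ^ (e - μ), hcase', Or.inr ?_⟩
        obtain ⟨h1, h2, h3⟩ := hcase y hy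
        have h4 : Nat.log 2 y = e := by omega
        rw [h4] at h3
        have h0 : y ≠ 0 := by
          have := Nat.pos_of_ne_zero (pow_ne_zero (μ + ν) (by norm_num : (2 : ℕ) ≠ 0))
          omega
        have h5 : μ + ν ≤ e := by
          rw [← h4]
          exact (Nat.le_log_iff_pow_le (by norm_num) h0).mpr h1
        have h6 : 2 ^ e ≤ y := by
          rw [← h4]
          exact Nat.pow_log_le_self 2 h0
        have h7 : 2 ^ μ ≤ w.2 := by
          rw [← h3, Nat.le_div_iff_mul_le (by positivity), ← pow_add]
          rwa [(by omega : μ + (e - μ) = e)]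
        have h8 : 2 ^ ν ≤ 2 ^ (e - μ) := Nat.pow_le_pow_right (by norm_num) (by omega)
        refine ⟨?_, by omega⟩
        have h9 : 1 ≤ 2 ^ (e - μ) := Nat.one_le_two_pow
        nlinarith [Nat.mul_le_mul_right (2 ^ (e - μ)) h7, Nat.mul_le_mul_right (2 ^ (e - μ)) hμ1]
      · exact ⟨0, 1, fun x hx => absurd ⟨x, hx⟩ hex, Or.inl rfl⟩

/-- A set of at least `n * K` elements contains `n` disjoint sets of size `K`. -/
theorem exists_disjoint_subsets_card_eq (K : ℕ) (hK : 1 ≤ K) (n : ℕ) (s : Finset V)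
    (hs : n * K ≤ #s) : ∃ F : Finset (Finset V), #F = n ∧ (∀ S ∈ F, S ⊆ s ∧ #S = K) ∧
      (F : Set (Finset V)).PairwiseDisjoint id := by
  induction n generalizing s with
  | zero => exact ⟨∅, rfl, by simp, by simp⟩
  | succ n ih =>
    rw [Nat.succ_mul] at hs
    obtain ⟨S, hS, hSK⟩ := exists_subset_card_eq (by omega : K ≤ #s)
    obtain ⟨F, hF, hFs, hFd⟩ := ih (s \ S) (by rw [card_sdiff_of_subset hS]; omega)
    have hdisj : ∀ T ∈ F, Disjoint S T := fun T hT =>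
      disjoint_of_subset_right (hFs T hT).1 disjoint_sdiff
    have hne : S ∉ F := fun h => by
      have := hdisj S h
      rw [disjoint_self_iff_empty] at this
      rw [this, card_empty] at hSK
      omega
    refine ⟨insert S F, by rw [card_insert_of_notMem hne, hF], fun T hT => ?_, ?_⟩
    · rcases mem_insert.mp hT with rfl | hT
      · exact ⟨hS, hSK⟩
      · exact ⟨(hFs T hT).1.trans sdiff_subset, (hFs T hT).2⟩
    · rw [coe_insert]
      exact hFd.insert fun T hT _ => hdisj T hT

/-- Splitting the leaves of stars according to a colouring and then into groups of size `K`, some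
colour class keeps most of its edges. -/
theorem exists_popular_groups {ι : Type*} (B : Finset V) (M : V → Finset V) (col : V → ι)
    (W : Finset ι) (K : ℕ) (hK : 1 ≤ K) (hW : ∀ b ∈ B, ∀ a ∈ M b, col a ∈ W)
    (hpos : 0 < ∑ b ∈ B, #(M b)) (hleft : 4 * (#B * #W * K) ≤ ∑ b ∈ B, #(M b)) :
    ∃ w, ∃ 𝒢 : Finset (V × Finset V), 𝒢.Nonempty ∧ (∀ g ∈ 𝒢, g.1 ∈ B) ∧
      (∀ g ∈ 𝒢, g.2 ⊆ M g.1) ∧ (∀ g ∈ 𝒢, ∀ a ∈ g.2, col a = w) ∧ (∀ g ∈ 𝒢, #g.2 = K) ∧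
      (∀ g ∈ 𝒢, ∀ g' ∈ 𝒢, g' ≠ g → g'.1 = g.1 → Disjoint g.2 g'.2) ∧
      3 * ∑ b ∈ B, #((M b).filter fun a => col a = w) ≤ 4 * (K * #𝒢) := by
  have hP : ∀ b w, ∃ F : Finset (Finset V),
      #((M b).filter fun a => col a = w) ≤ K * #F + K ∧
      (∀ S ∈ F, S ⊆ ((M b).filter fun a => col a = w) ∧ #S = K) ∧
      (F : Set (Finset V)).PairwiseDisjoint id := fun b w => by
    obtain ⟨F, hF, h⟩ := exists_disjoint_subsets_card_eq K hK
      (#((M b).filter fun a => col a = w) / K) _ (Nat.div_mul_le_self _ _)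
    refine ⟨F, ?_, h⟩
    rw [hF, mul_comm]
    exact (Nat.lt_div_mul_add (by omega)).le
  choose P hPcard hPsub hPdisj using hP
  obtain ⟨𝒢, h𝒢⟩ : ∃ 𝒢 : ι → Finset (V × Finset V), ∀ w, 𝒢 w =
      B.biUnion fun b => (P b w).image (Prod.mk b) := ⟨_, fun _ => rfl⟩
  have hmem : ∀ w, ∀ g ∈ 𝒢 w, g.1 ∈ B ∧ g.2 ∈ P g.1 w := fun w g hg => by
    rw [h𝒢] at hg
    obtain ⟨b, hb, hg⟩ := mem_biUnion.mp hg
    obtain ⟨S, hS, rfl⟩ := mem_image.mp hg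
    exact ⟨hb, hS⟩
  have hcard : ∀ w, #(𝒢 w) = ∑ b ∈ B, #(P b w) := fun w => by
    rw [h𝒢, card_biUnion]
    · exact sum_congr rfl fun b _ => card_image_of_injective _ (Prod.mk_right_injective b)
    · intro b _ b' _ hne
      refine disjoint_left.mpr fun g hg hg' => hne ?_
      obtain ⟨S, -, rfl⟩ := mem_image.mp hg
      obtain ⟨S', -, h⟩ := mem_image.mp hg'
      exact (congrArg Prod.fst h).symm
  have htotal : ∑ w ∈ W, ∑ b ∈ B, #((M b).filter fun a => col a = w) = ∑ b ∈ B, #(M b) := by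
    rw [sum_comm]
    exact sum_congr rfl fun b hb => (card_eq_sum_card_fiberwise (hW b hb)).symm
  have hloss : ∑ w ∈ W, ∑ b ∈ B, #((M b).filter fun a => col a = w) ≤
      K * ∑ w ∈ W, #(𝒢 w) + #B * #W * K := by
    calc _ ≤ ∑ w ∈ W, ∑ b ∈ B, (K * #(P b w) + K) :=
          sum_le_sum fun w _ => sum_le_sum fun b _ => hPcard b w
      _ = ∑ w ∈ W, (K * #(𝒢 w) + #B * K) := by
          refine sum_congr rfl fun w _ => ?_
          rw [sum_add_distrib, ← mul_sum, hcard, sum_const, smul_eq_mul]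
      _ = _ := by
          rw [sum_add_distrib, ← mul_sum, sum_const, smul_eq_mul]
          ring
  have hmain : ∃ w ∈ W, (𝒢 w).Nonempty ∧
      3 * ∑ b ∈ B, #((M b).filter fun a => col a = w) ≤ 4 * (K * #(𝒢 w)) := by
    by_contra! hcon
    have hge : 3 * ∑ w ∈ W, ∑ b ∈ B, #((M b).filter fun a => col a = w) ≤
        4 * (K * ∑ w ∈ W, #(𝒢 w)) := by omega
    have hle : ∀ w ∈ W, 4 * (K * #(𝒢 w)) ≤ 3 * ∑ b ∈ B, #((M b).filter fun a => col a = w) :=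
      fun w hw => by
        rcases (𝒢 w).eq_empty_or_nonempty with h | h
        · rw [h, card_empty, mul_zero, mul_zero]
          exact Nat.zero_le _
        · exact (hcon w hw h).le
    obtain ⟨w, hw, hne⟩ : ∃ w ∈ W, (𝒢 w).Nonempty := by
      by_contra! h
      have h0 : ∑ w ∈ W, #(𝒢 w) = 0 := sum_eq_zero fun w hw => by rw [h w hw, card_empty]
      rw [h0] at hge
      omega
    have hlt := sum_lt_sum hle ⟨w, hw, hcon w hw hne⟩
    simp only [← mul_sum] at hlt
    omega
  obtain ⟨w, -, hne, hw⟩ := hmain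
  refine ⟨w, 𝒢 w, hne, fun g hg => (hmem w g hg).1, fun g hg => ?_, fun g hg a ha => ?_,
    fun g hg => ?_, fun g hg g' hg' hgg' h => ?_, hw⟩
  · exact (hPsub g.1 w g.2 (hmem w g hg).2).1.trans (filter_subset _ _)
  · exact (mem_filter.mp ((hPsub g.1 w g.2 (hmem w g hg).2).1 ha)).2
  · exact (hPsub g.1 w g.2 (hmem w g hg).2).2
  · have h1 := (hmem w g' hg').2
    rw [h] at h1
    exact hPdisj g.1 w (hmem w g hg).2 h1 fun h2 => hgg' (Prod.ext h h2.symm)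

end Windows

section Core

open Finset Classical

/-- Stars in a `K_{t,t}`-free graph contain an almost-regular graph if the degrees of their leaves
lie in a short interval. -/
theorem KkkFree.hasAlmostRegularSubgraph_of_window [Fintype V] {G : SimpleGraph V} {t : ℕ}
    (hfree : KkkFree G t) (Z : Finset V) (𝒢 : Finset (V × Finset V)) (K K' N L h : ℕ) (ht : 2 ≤ t)
    (hK : 2 ≤ K) (hK' : K' = t * (t * K)) (hN : 2 * K * (t * K' ^ t) ≤ 2 ^ N)
    (h𝒢 : 𝒢.Nonempty) (hβ : ∀ g ∈ 𝒢, g.1 ∉ Z) (hZ : ∀ g ∈ 𝒢, g.2 ⊆ Z)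
    (hcard : ∀ g ∈ 𝒢, #g.2 = K') (hadj : ∀ g ∈ 𝒢, ∀ a ∈ g.2, G.Adj g.1 a)
    (hdisj : ∀ g ∈ 𝒢, ∀ g' ∈ 𝒢, g' ≠ g → g'.1 = g.1 → Disjoint g.2 g'.2)
    (hdeg : ∀ a, #(𝒢.filter fun g => a ∈ g.2) ≤ 2 ^ (L + h))
    (hcentre : ∀ b, 64 * K' * #(𝒢.filter fun g => g.1 = b) ≤ 2 ^ (L + h))
    (hcover : 3 * (#(𝒢.biUnion Prod.snd) * 2 ^ L) ≤ 4 * (K' * #𝒢))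
    (hwin : h = 1 ∨ (h + 1) * (K * ((3 * t) ^ t + 1) + 1) ≤ L ∧ N ≤ h + 1) :
    HasAlmostRegularSubgraph G 64 (K / 8) := by
  have hKK' : K ≤ K' := by
    rw [hK', ← mul_assoc]
    exact Nat.le_mul_of_pos_left K (Nat.mul_pos (by omega) (by omega))
  have hdeg' : ∀ a, (#(𝒢.filter fun g => a ∈ g.2) : ℝ) ≤ 2 ^ (L + h) := fun a => by
    exact_mod_cast hdeg a
  have hcentre' : ∀ b, 64 * K' * (#(𝒢.filter fun g => g.1 = b) : ℝ) ≤ 2 ^ (L + h) := fun b => by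
    exact_mod_cast hcentre b
  have hcover' : 3 * ((#(𝒢.biUnion Prod.snd) : ℝ) * 2 ^ L) ≤ 4 * (K' * #𝒢) := by
    exact_mod_cast hcover
  have hnn : (0 : ℝ) ≤ K' * #𝒢 := by positivity
  rcases hwin with rfl | ⟨hwin, hNh⟩
  · have hlow := hasAlmostRegularSubgraph_of_degrees_le (G := G) Z 𝒢 K' (2 ^ (L + 1))
      (hK.trans hKK') h𝒢 hβ hZ hcard hadj hdisj hdeg' hcentre' (by rw [pow_succ]; linarith)
    refine hlow.mono ?_
    have : (K : ℝ) ≤ K' := by exact_mod_cast hKK'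
    linarith
  · obtain ⟨Y, hY⟩ : ∃ Y : ℝ, Y = t * K' ^ t := ⟨_, rfl⟩
    obtain ⟨Q, hQ⟩ : ∃ Q : ℝ, Q = 2 ^ (h + 1) := ⟨_, rfl⟩
    have hKR : (2 : ℝ) ≤ K := by exact_mod_cast hK
    have htR : (2 : ℝ) ≤ t := by exact_mod_cast ht
    have hK'R : (1 : ℝ) ≤ K' := by exact_mod_cast (by omega : 1 ≤ K')
    have htY : (t : ℝ) ≤ Y := by
      rw [hY]
      exact le_mul_of_one_le_right (by linarith) (one_le_pow₀ hK'R)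
    have hQY : 2 * K * Y ≤ Q := by
      rw [hY, hQ]
      exact_mod_cast hN.trans (Nat.pow_le_pow_right (by norm_num) hNh)
    have hQ1 : 1 ≤ Q := by rw [hQ]; exact one_le_pow₀ (by norm_num)
    have hQ0 : 0 < Q := by linarith
    have hY0 : 0 < Y := by linarith
    have hYQ : 2 * Y ≤ Q := by nlinarith
    have hKQ : 2 * K ≤ Q := by nlinarith
    have hQΔ : Q ^ (K * ((3 * t) ^ t + 1) + 1) ≤ 2 ^ (L + h) := by
      rw [hQ, ← pow_mul]
      exact pow_le_pow_right₀ (by norm_num) (by omega)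
    have hpow : ∀ m n : ℕ, m ≤ n → Q ^ m ≤ Q ^ n := fun m n hmn => pow_le_pow_right₀ hQ1 hmn
    have hexp : ∀ k ≤ t, (3 * t) ^ k ≤ (3 * t) ^ t := fun k hk =>
      Nat.pow_le_pow_right (by omega) hk
    refine hfree.hasAlmostRegularSubgraph_of_high_degrees Z 𝒢 K K' (2 ^ (L + h)) Y
      (fun k => Q ^ (3 * t) ^ k) ht hK hK' hY (by positivity) h𝒢 hβ hZ hcard hadj hdisj hdeg'
      hcentre' (fun k => one_le_pow₀ hQ1) ?_ (fun k hk hkt => ?_) (fun k hk hkt => ?_) ?_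
    · have h1 : Q ≤ Q ^ (3 * t) ^ 1 := by
        conv_lhs => rw [← pow_one Q]
        exact hpow _ _ (by rw [pow_one]; omega)
      refine le_trans ?_ (mul_le_mul_of_nonneg_right (mul_le_mul_of_nonneg_right h1 (by linarith))
        (Nat.cast_nonneg _))
      rw [hQ, pow_add, pow_succ]
      have h2 : (0 : ℝ) ≤ 2 ^ h := by positivity
      nlinarith [mul_le_mul_of_nonneg_left hcover' h2, mul_nonneg h2 hnn]
    · calc 2 * K * (Q ^ (3 * t) ^ k * Y) ^ t ≤ Q * (Q ^ (3 * t) ^ k * Q) ^ t := by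
            refine mul_le_mul hKQ (pow_le_pow_left₀ (by positivity) ?_ t) (by positivity) hQ0.le
            exact mul_le_mul_of_nonneg_left (by linarith) (by positivity)
        _ = Q ^ (((3 * t) ^ k + 1) * t + 1) := by rw [← pow_succ, ← pow_mul, ← pow_succ']
        _ ≤ Q ^ (3 * t) ^ (k + 1) := by
            refine hpow _ _ ?_
            have : 1 ≤ (3 * t) ^ k := Nat.one_le_pow _ _ (by omega)
            rw [pow_succ]
            nlinarith
    · calc 2 * Y * (Q ^ (3 * t) ^ k * Y) ^ K ≤ Q * (Q ^ (3 * t) ^ k * Q) ^ K := by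
            refine mul_le_mul hYQ (pow_le_pow_left₀ (by positivity) ?_ K) (by positivity) hQ0.le
            exact mul_le_mul_of_nonneg_left (by linarith) (by positivity)
        _ = Q ^ (((3 * t) ^ k + 1) * K + 1) := by rw [← pow_succ, ← pow_mul, ← pow_succ']
        _ ≤ Q ^ (K * ((3 * t) ^ t + 1) + 1) := by
            refine hpow _ _ ?_
            have := hexp k hkt.le
            nlinarith
        _ ≤ _ := hQΔ
    · calc (t : ℝ) * Q ^ (3 * t) ^ t < Q * Q ^ (3 * t) ^ t :=
            mul_lt_mul_of_pos_right (by linarith) (by positivity)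
        _ = Q ^ ((3 * t) ^ t + 1) := (pow_succ' _ _).symm
        _ ≤ Q ^ (K * ((3 * t) ^ t + 1) + 1) := hpow _ _
            (Nat.add_le_add_right ((Nat.le_succ _).trans (Nat.le_mul_of_pos_left _ (by omega))) 1)
        _ ≤ _ := hQΔ

/-- A `K_{t,t}`-free graph of large minimum degree on a set of vertices contains an almost-regular
subgraph. -/
theorem KkkFree.hasAlmostRegularSubgraph_of_minDegree [Fintype V] {G : SimpleGraph V} {t : ℕ}
    (hfree : KkkFree G t) (K K' N τ : ℕ) (U : Finset V) (hU : U.Nonempty) (ht : 2 ≤ t)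
    (hK : 2 ≤ K) (hK' : K' = t * (t * K)) (hN1 : 1 ≤ N) (hN : 2 * K * (t * K' ^ t) ≤ 2 ^ N)
    (hτ : 16 * (8 * (K * ((3 * t) ^ t + 1) + 1) *
      (N + Nat.log 2 (Nat.log 2 (Fintype.card V)) + 1) * K') ≤ τ)
    (hdegU : ∀ v ∈ U, 512 * τ ≤ #(U.filter (G.Adj v))) :
    HasAlmostRegularSubgraph G 64 (K / 8) := by
  have hKK' : K ≤ K' := by
    rw [hK', ← mul_assoc]
    exact Nat.le_mul_of_pos_left K (Nat.mul_pos (by omega) (by omega))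
  have hτ1 : 1 ≤ τ := by
    refine le_trans ?_ hτ
    have : 0 < 16 * (8 * (K * ((3 * t) ^ t + 1) + 1) *
      (N + Nat.log 2 (Nat.log 2 (Fintype.card V)) + 1) * K') := by
      have : 0 < K' := by omega
      positivity
    exact this
  have hN' : ∀ v, ∃ S : Finset V, v ∈ U → S ⊆ U.filter (G.Adj v) ∧ #S = 512 * τ := fun v => by
    by_cases hv : v ∈ U
    · obtain ⟨S, hS⟩ := exists_subset_card_eq (hdegU v hv)
      exact ⟨S, fun _ => hS⟩
    · exact ⟨∅, fun h => absurd h hv⟩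
  choose Nb hNb using hN'
  have hNadj : ∀ b ∈ U, ∀ a ∈ Nb b, G.Adj b a := fun b hb a ha =>
    (mem_filter.mp ((hNb b hb).1 ha)).2
  obtain ⟨Z, B, hBU, hBZ, M, hMN, hMZ, hMτ, hMdeg, hMtot⟩ :=
    exists_bipartition_of_card_eq U Nb τ hτ1 hU
      (fun b hb => (hNb b hb).1.trans (filter_subset _ _))
      (fun b hb h => G.loopless.irrefl b (hNadj b hb b h)) fun b hb => (hNb b hb).2
  obtain ⟨dg, hdg⟩ : ∃ dg : V → ℕ, ∀ a, dg a = #(B.filter fun b => a ∈ M b) := ⟨_, fun _ => rfl⟩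
  obtain ⟨key, hkey, hwin⟩ := exists_windows (K * ((3 * t) ^ t + 1) + 1) N
    (Nat.log 2 (Fintype.card V)) (by omega) hN1
  have hUpos : 0 < #U := card_pos.mpr hU
  have htot : τ * #U ≤ 4 * ∑ b ∈ B, #(M b) := by
    have h1 : (τ * #U : ℝ) ≤ 4 * ∑ b ∈ B, (#(M b) : ℝ) := by linarith
    exact_mod_cast h1
  obtain ⟨w, 𝒢, h𝒢, h𝒢B, h𝒢M, h𝒢w, h𝒢K, h𝒢d, h𝒢c⟩ := exists_popular_groups B M
    (fun a => key (Nat.log 2 (dg a))) ((range (Nat.log 2 (Fintype.card V) + 1)).image key) K'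
    (by omega) (fun b _ a _ => mem_image_of_mem _ (mem_range.mpr (Nat.lt_succ_of_le
      (Nat.log_mono_right (by rw [hdg]; exact card_le_univ _))))) (by
      have := Nat.mul_pos hτ1 hUpos
      omega) (by
      have h1 := Nat.mul_le_mul_right #U hτ
      have h2 := Nat.mul_le_mul_right K' (Nat.mul_le_mul (card_le_card hBU) hkey)
      nlinarith)
  obtain ⟨L, h, hLh, hor⟩ := hwin w
  have hLdeg : ∀ a, (∃ g ∈ 𝒢, a ∈ g.2) → 128 * τ ≤ dg a ∧ 2 ^ L ≤ dg a ∧ dg a ≤ 2 ^ (L + h) := by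
    rintro a ⟨g, hg, ha⟩
    obtain ⟨h1, h2⟩ := hLh _ (h𝒢w g hg a ha)
    have h3 : 128 * τ ≤ dg a := by
      rw [hdg]
      exact hMdeg g.1 a (h𝒢M g hg ha)
    have h0 : dg a ≠ 0 := by omega
    refine ⟨h3, (Nat.pow_le_pow_right (by norm_num) h1).trans (Nat.pow_log_le_self 2 h0), ?_⟩
    exact (Nat.lt_pow_succ_log_self (by norm_num) _).le.trans
      (Nat.pow_le_pow_right (by norm_num) h2)
  have hexists : ∃ a, ∃ g ∈ 𝒢, a ∈ g.2 := by
    obtain ⟨g, hg⟩ := h𝒢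
    obtain ⟨a, ha⟩ : g.2.Nonempty := by
      rw [← card_pos, h𝒢K g hg]
      omega
    exact ⟨a, g, hg, ha⟩
  refine hfree.hasAlmostRegularSubgraph_of_window Z 𝒢 K K' N L h ht hK hK' hN h𝒢
    (fun g hg => disjoint_left.mp hBZ (h𝒢B g hg)) (fun g hg => (h𝒢M g hg).trans (hMZ _)) h𝒢K
    (fun g hg a ha => hNadj g.1 (hBU (h𝒢B g hg)) a (hMN _ (h𝒢M g hg ha))) h𝒢d (fun a => ?_)
    (fun b => ?_) ?_ hor
  · by_cases ha : ∃ g ∈ 𝒢, a ∈ g.2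
    · refine le_trans ?_ (hLdeg a ha).2.2
      rw [hdg]
      refine card_le_card_of_injOn Prod.fst (fun g hg => ?_) fun g hg g' hg' hgg' => ?_
      · obtain ⟨h1, h2⟩ := mem_filter.mp (mem_coe.mp hg)
        exact mem_coe.mpr (mem_filter.mpr ⟨h𝒢B g h1, h𝒢M g h1 h2⟩)
      · obtain ⟨h1, h2⟩ := mem_filter.mp (mem_coe.mp hg)
        obtain ⟨h1', h2'⟩ := mem_filter.mp (mem_coe.mp hg')
        by_contra hne
        exact disjoint_left.mp (h𝒢d g h1 g' h1' (Ne.symm hne) hgg'.symm) h2 h2'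
    · rw [filter_false_of_mem fun g hg hag => ha ⟨g, hg, hag⟩, card_empty]
      exact Nat.zero_le _
  · obtain ⟨a, ha⟩ := hexists
    obtain ⟨h1, -, h3⟩ := hLdeg a ha
    have h4 : #(𝒢.filter fun g => g.1 = b) * K' ≤ 2 * τ := by
      refine le_trans ?_ (hMτ b)
      rw [← sum_const_nat fun g hg => h𝒢K g (mem_filter.mp hg).1, ← card_biUnion]
      · refine card_le_card fun v hv => ?_
        obtain ⟨g, hg, hvg⟩ := mem_biUnion.mp hv
        obtain ⟨hg1, hg2⟩ := mem_filter.mp hg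
        rw [← hg2]
        exact h𝒢M g hg1 hvg
      · intro g hg g' hg' hne
        obtain ⟨hg1, hg2⟩ := mem_filter.mp hg
        obtain ⟨hg1', hg2'⟩ := mem_filter.mp hg'
        exact h𝒢d g hg1 g' hg1' (Ne.symm hne) (hg2'.trans hg2.symm)
    refine le_trans ?_ (h1.trans h3)
    nlinarith
  · refine le_trans (Nat.mul_le_mul_left 3 ?_) h𝒢c
    refine le_trans (b := ∑ a ∈ 𝒢.biUnion Prod.snd, dg a) ?_ ?_
    · rw [← smul_eq_mul]
      refine card_nsmul_le_sum _ _ _ fun a ha => ?_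
      obtain ⟨g, hg, hag⟩ := mem_biUnion.mp ha
      exact (hLdeg a ⟨g, hg, hag⟩).2.1
    · simp_rw [hdg, card_filter]
      rw [sum_comm]
      refine sum_le_sum fun b _ => ?_
      rw [← card_filter, ← card_filter]
      refine card_le_card fun a ha => ?_
      obtain ⟨ha1, ha2⟩ := mem_filter.mp ha
      obtain ⟨g, hg, hag⟩ := mem_biUnion.mp ha1
      have h2 := h𝒢w g hg a hag
      rw [hdg] at h2
      simp only [card_filter] at h2
      exact mem_filter.mpr ⟨ha2, h2⟩

end Core

section Final

open Finset Classical

theorem KkkFree.mono {G : SimpleGraph V} {s t : ℕ} (hfree : KkkFree G s) (hst : s ≤ t) :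
    KkkFree G t := by
  rintro ⟨S, T, hST, hS, hT, hadj⟩
  obtain ⟨S', hS', hSc⟩ := exists_subset_card_eq (hst.trans hS.ge)
  obtain ⟨T', hT', hTc⟩ := exists_subset_card_eq (hst.trans hT.ge)
  exact hfree ⟨S', T', disjoint_of_subset_left hS' (disjoint_of_subset_right hT' hST), hSc, hTc,
    fun u hu v hv => hadj u (hS' hu) v (hT' hv)⟩

theorem two_mul_edgeCount_eq [Fintype V] (G : SimpleGraph V) :
    2 * edgeCount G = #(((univ : Finset V) ×ˢ univ).filter fun e => G.Adj e.1 e.2) := by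
  have h1 : edgeCount G = #G.edgeFinset := by
    rw [edgeCount, ← SimpleGraph.coe_edgeFinset, Set.ncard_coe_finset]
  rw [h1, ← G.sum_degrees_eq_twice_card_edges, card_filter, sum_product]
  refine sum_congr rfl fun v _ => ?_
  rw [← card_filter, ← G.card_neighborFinset_eq_degree, G.neighborFinset_eq_filter]

/-- A graph with an edge contains a `1`-regular subgraph. -/
theorem hasAlmostRegularSubgraph_one [Fintype V] {G : SimpleGraph V} (h : 0 < edgeCount G) :
    HasAlmostRegularSubgraph G 64 1 := by
  have h1 := two_mul_edgeCount_eq G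
  obtain ⟨⟨u, v⟩, huv⟩ := card_pos.mp (by omega :
    0 < #(((univ : Finset V) ×ˢ univ).filter fun e => G.Adj e.1 e.2))
  have hadj : G.Adj u v := (mem_filter.mp huv).2
  have hcard : #({u, v} : Finset V) = 2 := card_pair hadj.ne
  refine hasAlmostRegularSubgraph_of_card_adj (Γ := G) le_rfl (by norm_num) {u, v} ⟨u, by simp⟩
    (fun w hw => ?_) fun w _ => ?_
  · have h2 : 0 < #(({u, v} : Finset V).filter (G.Adj w)) := by
      rw [card_pos]
      rcases mem_insert.mp hw with rfl | hw
      · exact ⟨v, mem_filter.mpr ⟨by simp, hadj⟩⟩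
      · rw [mem_singleton.mp hw]
        exact ⟨u, mem_filter.mpr ⟨by simp, hadj.symm⟩⟩
    exact_mod_cast h2
  · have h2 : #(({u, v} : Finset V).filter (G.Adj w)) ≤ 64 := by
      have := card_filter_le ({u, v} : Finset V) (G.Adj w)
      omega
    rw [mul_one]
    exact_mod_cast h2

/-- A `K_{t,t}`-free graph of average degree large compared to `K` and to `log log n` contains an
almost-regular subgraph of average degree at least `K / 8`. -/
theorem KkkFree.hasAlmostRegularSubgraph_of_avgDeg [Fintype V] [Nonempty V] {G : SimpleGraph V}
    {t : ℕ} (hfree : KkkFree G t) (K : ℕ) (ht : 2 ≤ t) (hK : 8 ≤ K)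
    (hd : (2 ^ 20 * ((3 * t) ^ t + 2) * t ^ 4 : ℕ) *
      (K ^ 2 * (Nat.log 2 K + Nat.log 2 (Nat.log 2 (Fintype.card V)) + 1) : ℕ) ≤ avgDeg G) :
    HasAlmostRegularSubgraph G 64 (K / 8) := by
  obtain ⟨l, hl⟩ : ∃ l, l = Nat.log 2 K := ⟨_, rfl⟩
  obtain ⟨x, hx⟩ : ∃ x, x = Nat.log 2 (Nat.log 2 (Fintype.card V)) := ⟨_, rfl⟩
  obtain ⟨E, hE⟩ : ∃ E, E = (3 * t) ^ t := ⟨_, rfl⟩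
  obtain ⟨N, hN⟩ : ∃ N, N = (2 + 2 * t + 2 * t ^ 2) * (l + 1) := ⟨_, rfl⟩
  obtain ⟨τ, hτ⟩ : ∃ τ, τ = 16 * (8 * (K * (E + 1) + 1) * (N + x + 1) * (t * (t * K))) :=
    ⟨_, rfl⟩
  rw [← hl, ← hx, ← hE] at hd
  have hKl : K ≤ 2 ^ (l + 1) := by
    rw [hl]
    exact (Nat.lt_pow_succ_log_self (by norm_num) _).le
  have htt : t ≤ 2 ^ t := Nat.lt_two_pow_self.le
  have hl3 : 3 ≤ l := by
    rw [hl]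
    exact (Nat.le_log_iff_pow_le (by norm_num) (by omega)).mpr (by omega)
  have hNpow : 2 * K * (t * (t * (t * K)) ^ t) ≤ 2 ^ N := by
    calc 2 * K * (t * (t * (t * K)) ^ t)
        ≤ 2 * 2 ^ (l + 1) * (2 ^ t * (2 ^ t * (2 ^ t * 2 ^ (l + 1))) ^ t) := by gcongr
      _ = 2 ^ (1 + (l + 1) + (t + (t + (t + (l + 1))) * t)) := by
          simp only [pow_add, pow_mul, pow_one]
      _ ≤ 2 ^ N := by
          refine Nat.pow_le_pow_right (by norm_num) ?_
          rw [hN]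
          nlinarith [Nat.zero_le (t * l), Nat.zero_le (t ^ 2 * l)]
  have hτd : 1024 * τ ≤ (2 ^ 20 * (E + 2) * t ^ 4) * (K ^ 2 * (l + x + 1)) := by
    have h1 : K * (E + 1) + 1 ≤ K * (E + 2) := by nlinarith
    have h2 : N + x + 1 ≤ 8 * t ^ 2 * (l + x + 1) := by
      rw [hN]
      have h3 : 2 + 2 * t + 2 * t ^ 2 ≤ 4 * t ^ 2 := by nlinarith
      have h4 : 1 ≤ t ^ 2 := Nat.one_le_pow _ _ (by omega)
      nlinarith [Nat.mul_le_mul_right (l + 1) h3, Nat.mul_le_mul_right x h4,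
        Nat.mul_le_mul_right l h4]
    calc 1024 * τ = 2 ^ 17 * ((K * (E + 1) + 1) * (N + x + 1) * (t * (t * K))) := by
          rw [hτ]; ring
      _ ≤ 2 ^ 17 * (K * (E + 2) * (8 * t ^ 2 * (l + x + 1)) * (t * (t * K))) := by gcongr
      _ = 2 ^ 20 * (E + 2) * t ^ 4 * (K ^ 2 * (l + x + 1)) := by ring
  have hτd' : (1024 * τ : ℝ) ≤ avgDeg G := by
    refine le_trans ?_ hd
    exact_mod_cast hτd
  have hn : (0 : ℝ) < Fintype.card V := by exact_mod_cast Fintype.card_pos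
  obtain ⟨U, -, hU, hdegU⟩ := exists_subset_le_card_adj G (avgDeg G / 2) univ univ_nonempty (by
    have h1 : ((2 * edgeCount G : ℕ) : ℝ) = _ := congrArg Nat.cast (two_mul_edgeCount_eq G)
    rw [← h1, card_univ, avgDeg]
    push_cast
    field_simp
    rfl)
  refine hfree.hasAlmostRegularSubgraph_of_minDegree K (t * (t * K)) N τ U hU ht (by omega) rfl ?_
    hNpow ?_ fun v hv => ?_
  · rw [hN]
    exact Nat.mul_pos (by omega) (by omega)
  · rw [hτ, hE, hx]
  · have h1 : (512 * τ : ℝ) ≤ #(U.filter (G.Adj v)) := le_trans (by linarith) (hdegU v hv)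
    exact_mod_cast h1

theorem natLog_le_logb {n : ℕ} (hn : n ≠ 0) : (Nat.log 2 n : ℝ) ≤ Real.logb 2 n := by
  rw [Real.le_logb_iff_rpow_le (by norm_num) (by positivity), Real.rpow_natCast]
  exact_mod_cast Nat.pow_log_le_self 2 hn

end Final

/-- For every `t` there is `ε_t > 0` such that every `K_{t,t}`-free graph on `n ≥ 16`
vertices with average degree `d ≥ 2·log₂ log₂ n` has a `64`-almost-regular subgraph with
average degree at least `ε_t·(d/log₂ log₂ n)^{1/2}/log₂(d/log₂ log₂ n)`. -/
theorem large_average_degree_almost_regular_subgraph_ktt_free (t : ℕ) (ht : 0 < t) :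
    ∃ ε : ℝ, 0 < ε ∧
      ∀ (V : Type) [Fintype V] (G : SimpleGraph V), 16 ≤ Fintype.card V →
        KkkFree G t →
        2 * Real.logb 2 (Real.logb 2 (Fintype.card V : ℝ)) ≤ avgDeg G →
        HasAlmostRegularSubgraph G 64
          (ε * (avgDeg G / Real.logb 2 (Real.logb 2 (Fintype.card V : ℝ))) ^ ((1 : ℝ) / 2) /
            Real.logb 2
              (avgDeg G / Real.logb 2 (Real.logb 2 (Fintype.card V : ℝ)))) := by
  obtain ⟨s, hs⟩ : ∃ s, s = t + 1 := ⟨_, rfl⟩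
  obtain ⟨C, hC⟩ : ∃ C : ℕ, C = 2 ^ 20 * ((3 * s) ^ s + 2) * s ^ 4 := ⟨_, rfl⟩
  have hC1 : 2 ^ 20 ≤ C := by
    rw [hC, mul_assoc]
    exact Nat.le_mul_of_pos_right _ (Nat.mul_pos (by omega) (pow_pos (by omega) 4))
  have hCR : (2 ^ 20 : ℝ) ≤ C := by exact_mod_cast hC1
  have hC0 : (0 : ℝ) < C := by linarith
  refine ⟨1 / C, by positivity, fun V _ G hn hfree hd => ?_⟩
  have : Nonempty V := Fintype.card_pos_iff.mp (by omega)
  obtain ⟨d, hdd⟩ : ∃ d, d = avgDeg G := ⟨_, rfl⟩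
  obtain ⟨ℓ, hℓ⟩ : ∃ ℓ, ℓ = Real.logb 2 (Real.logb 2 (Fintype.card V : ℝ)) := ⟨_, rfl⟩
  obtain ⟨D, hD⟩ : ∃ D, D = d / ℓ := ⟨_, rfl⟩
  obtain ⟨lam, hlam⟩ : ∃ lam, lam = Real.logb 2 D := ⟨_, rfl⟩
  obtain ⟨T, hT⟩ : ∃ T, T = 1 / C * √D / lam := ⟨_, rfl⟩
  rw [← hdd, ← hℓ] at hd
  rw [← hdd, ← hℓ, ← hD, ← Real.sqrt_eq_rpow, ← hlam, ← hT]
  have hnR : (16 : ℝ) ≤ Fintype.card V := by exact_mod_cast hn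
  have hlog4 : 4 ≤ Real.logb 2 (Fintype.card V : ℝ) := by
    rw [Real.le_logb_iff_rpow_le (by norm_num) (by linarith)]
    norm_num
    exact hn
  have hℓ2 : 2 ≤ ℓ := by
    rw [hℓ, Real.le_logb_iff_rpow_le (by norm_num) (by linarith)]
    norm_num
    exact hlog4
  have hD2 : 2 ≤ D := by
    rw [hD, le_div_iff₀ (by linarith)]
    exact hd
  have hDd : D * ℓ = d := by
    rw [hD]
    exact div_mul_cancel₀ _ (by linarith)
  have hlam1 : 1 ≤ lam := by
    rw [hlam, Real.le_logb_iff_rpow_le (by norm_num) (by linarith)]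
    simpa using hD2
  by_cases hT1 : T ≤ 1
  · refine (hasAlmostRegularSubgraph_one (Nat.pos_of_ne_zero fun h0 => ?_)).mono hT1
    rw [avgDeg, h0] at hdd
    simp only [Nat.cast_zero, mul_zero, zero_div] at hdd
    linarith
  · rw [not_le] at hT1
    obtain ⟨K, hK⟩ : ∃ K, K = ⌈8 * T⌉₊ := ⟨_, rfl⟩
    have hKT : 8 * T ≤ K := by
      rw [hK]
      exact Nat.le_ceil _
    have hK9 : (K : ℝ) ≤ 9 * T := by
      have := Nat.ceil_lt_add_one (by linarith : 0 ≤ 8 * T)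
      rw [← hK] at this
      linarith
    have hK8R : (8 : ℝ) ≤ K := by linarith
    have hK8 : 8 ≤ K := by exact_mod_cast hK8R
    have hsqrt0 : 0 ≤ √D := Real.sqrt_nonneg D
    have hsq : √D * √D = D := Real.mul_self_sqrt (by linarith)
    have hKlam : K * lam * C ≤ 9 * √D := by
      have h1 : T * lam * C = √D := by
        rw [hT]
        field_simp
      calc K * lam * C ≤ 9 * T * lam * C := by gcongr
        _ = 9 * (T * lam * C) := by ring
        _ = _ := by rw [h1]
    have hKsq : (K : ℝ) ^ 2 * lam ^ 2 * C ^ 2 ≤ 81 * D := by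
      have h1 := mul_self_le_mul_self (by positivity) hKlam
      nlinarith
    have hKD : (K : ℝ) ≤ D := by
      have h1 : (K : ℝ) * 9 ≤ K * lam * C := by
        rw [mul_assoc]
        refine mul_le_mul_of_nonneg_left ?_ (by linarith)
        nlinarith
      have h2 : √D ≤ D := by
        rw [Real.sqrt_le_left (by linarith)]
        nlinarith
      linarith
    have hl : (Nat.log 2 K : ℝ) ≤ lam := by
      rw [hlam]
      exact (natLog_le_logb (by omega)).trans
        (Real.logb_le_logb_of_le (by norm_num) (by linarith) hKD)
    have hx : (Nat.log 2 (Nat.log 2 (Fintype.card V)) : ℝ) ≤ ℓ := by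
      have h1 : Nat.log 2 (Fintype.card V) ≠ 0 := by
        have := (Nat.le_log_iff_pow_le (b := 2) (x := 4) (by norm_num)
          (by omega : Fintype.card V ≠ 0)).mpr (by omega)
        omega
      rw [hℓ]
      exact (natLog_le_logb h1).trans (Real.logb_le_logb_of_le (by norm_num)
        (by exact_mod_cast Nat.pos_of_ne_zero h1) (natLog_le_logb (by omega)))
    refine ((hfree.mono (by omega : t ≤ s)).hasAlmostRegularSubgraph_of_avgDeg K (by omega) hK8
      ?_).mono (by linarith : T ≤ K / 8)
    rw [← hC, ← hdd]
    push_cast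
    have hsum : (Nat.log 2 K : ℝ) + Nat.log 2 (Nat.log 2 (Fintype.card V)) + 1 ≤
        3 * (lam ^ 2 * ℓ) := by
      have h1 : lam ≤ lam ^ 2 := by nlinarith
      have h2 : lam ^ 2 ≤ lam ^ 2 * ℓ := le_mul_of_one_le_right (by positivity) (by linarith)
      have h3 : ℓ ≤ lam ^ 2 * ℓ := le_mul_of_one_le_left (by linarith) (by linarith)
      linarith
    have hbound : (C : ℝ) * (K ^ 2 * (Nat.log 2 K + Nat.log 2 (Nat.log 2 (Fintype.card V)) + 1)) * C
        ≤ 243 * d := by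
      calc _ ≤ (C : ℝ) * (K ^ 2 * (3 * (lam ^ 2 * ℓ))) * C := by gcongr
        _ = 3 * (K ^ 2 * lam ^ 2 * C ^ 2) * ℓ := by ring
        _ ≤ 3 * (81 * D) * ℓ := by gcongr
        _ = 243 * d := by rw [← hDd]; ring
    have hd0 : 0 ≤ d := by linarith
    refine le_of_mul_le_mul_right (hbound.trans ?_) hC0
    nlinarith
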